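/- arXiv:2301.09473 — 3 statements merged into one kernel-verified Lean document; each statement's English description precedes it below -/
import Mathlib

section
/- Arcsine sum rule: For every nontrivial probability measure μ on [−2,2] with canonical moments (u_k)_{k≥1}, one has K(Arcsine | μ) = −∑_{k=1}^∞ log(1−u_k²), where both sides may be infinite simultaneously. -/
open MeasureTheory Real Filter Set Topology Polynomial
open scoped ENNReal ComplexConjugate

noncomputable section

namespace SumRules

-- Kullback–Leibler divergence `K(ν | μ)`.
open Classical in
def KLdiv {α : Type*} [MeasurableSpace α] (ν μ : Measure α) : ℝ≥0∞ :=
  if ν ≪ μ ∧ Integrable (llr ν μ) ν then ENNReal.ofReal (∫ x, llr ν μ x ∂ν) else ⊤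

/-- The (topological) support of a measure. -/
def suppSet {α : Type*} [TopologicalSpace α] [MeasurableSpace α] (μ : Measure α) : Set α :=
  {x | ∀ U ∈ nhds x, μ U ≠ 0}

/-- A measure is nontrivial if its support is infinite, i.e. it is not carried
by any finite set. -/
def InfiniteSupport {α : Type*} [MeasurableSpace α] (μ : Measure α) : Prop :=
  ∀ s : Finset α, μ (↑s : Set α)ᶜ ≠ 0

/-- The set of support points outside `[cm, cp]`. -/
def ES (μ : Measure ℝ) (cm cp : ℝ) : Set ℝ := suppSet μ \ Icc cm cp

/-- `μ ∈ 𝒮₁(cm, cp)`: the support of `μ` is contained in `[cm, cp]` together with an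
at most countable set of points outside this interval. -/
def InS1 (μ : Measure ℝ) (cm cp : ℝ) : Prop := (ES μ cm cp).Countable

/-- `a b` (indexed so that `a (k+1) = a_{k+1}`, `b (k+1) = b_{k+1}`, `k ≥ 0`) are the Jacobi
coefficients of `μ`: there is a sequence of orthonormal polynomials (with positive leading
coefficients, obtained by Gram-Schmidt from `1, x, x², …`) satisfying the three-term recursion. -/
def IsJacobi (μ : Measure ℝ) (a b : ℕ → ℝ) : Prop :=
  (∀ k : ℕ, 0 < a (k+1)) ∧
  ∃ p : ℕ → Polynomial ℝ,
    (∀ k, (p k).natDegree = k) ∧ (∀ k, 0 < (p k).leadingCoeff) ∧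
    (∀ j k, ∫ x, (p j).eval x * (p k).eval x ∂μ = if j = k then 1 else 0) ∧
    (∀ (k : ℕ) (x : ℝ), x * (p k).eval x =
      a (k+1) * (p (k+1)).eval x + b (k+1) * (p k).eval x +
        (if k = 0 then 0 else a k * (p (k-1)).eval x))

/-- `u` is the sequence of canonical moments of a measure on `[-2,2]` (with `u 0 = -1`). -/
def IsCanonicalMoments (μ : Measure ℝ) (u : ℕ → ℝ) : Prop :=
  u 0 = -1 ∧ (∀ k : ℕ, u (k+1) ∈ Ioo (-1 : ℝ) 1) ∧
  ∃ a b : ℕ → ℝ, IsJacobi μ a b ∧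
    (∀ k : ℕ, b (k+1) = (1 - u (2*k)) * u (2*k+1) - (1 + u (2*k)) * u (2*k-1)) ∧
    (∀ k : ℕ, (a (k+1))^2 = (1 - u (2*k)) * (1 - (u (2*k+1))^2) * (1 + u (2*k+2)))

/-- `z` is the sequence of canonical coefficients of a measure supported in `[0,∞)`. -/
def IsCanonicalZ (μ : Measure ℝ) (z : ℕ → ℝ) : Prop :=
  z 0 = 0 ∧ (∀ k : ℕ, 0 ≤ z (k+1)) ∧
  ∃ a b : ℕ → ℝ, IsJacobi μ a b ∧
    (∀ k : ℕ, b (k+1) = z (2*k) + z (2*k+1)) ∧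
    (∀ k : ℕ, (a (k+1))^2 = z (2*k+1) * z (2*k+2))

def Gfun (x : ℝ) : ℝ := x - 1 - Real.log x

/-- The semicircle law. -/
def SCm : Measure ℝ :=
  volume.withDensity fun x => ENNReal.ofReal (Real.sqrt (4 - x^2) / (2*π))

/-- The arcsine law on `(-2,2)`. -/
def ArcsineM : Measure ℝ :=
  volume.withDensity fun x => ENNReal.ofReal (1 / (π * Real.sqrt (4 - x^2)))

/-- The measure with density `(2/(π|q-p|)) √((x-p)/(q-x))` between `p` and `q`. -/
def Dmeas (p q : ℝ) : Measure ℝ :=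
  volume.withDensity fun x => ENNReal.ofReal (2/(π * |q - p|) * Real.sqrt ((x - p)/(q - x)))

/-- The point `e^{iθ}` on the unit circle. -/
def ctheta (θ : ℝ) : ℂ := Complex.exp (θ * Complex.I)

/-- Reversed polynomial `Φ*` with conjugated coefficients: `Φ*(z) = z^k conj(Φ(1/conj z))`. -/
def polyStar (P : Polynomial ℂ) : Polynomial ℂ := (P.map (starRingEnd ℂ)).reverse

/-- `α` is the sequence of Verblunsky coefficients of the measure `ν` on the unit circle
(`ν` being given in angle coordinates, carried by `[0, 2π)`): the monic orthogonal
polynomials of `ν` satisfy the Szegő recursion with coefficients `α`. -/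
def IsVerblunsky (ν : Measure ℝ) (α : ℕ → ℂ) : Prop :=
  (∀ k, ‖α k‖ < 1) ∧
  ∃ Φ : ℕ → Polynomial ℂ,
    (∀ k, (Φ k).Monic) ∧ (∀ k, (Φ k).natDegree = k) ∧
    (∀ j k, j ≠ k →
      ∫ θ, conj ((Φ j).eval (ctheta θ)) * (Φ k).eval (ctheta θ) ∂ν = 0) ∧
    (∀ k, Φ (k+1) = Polynomial.X * Φ k - Polynomial.C (conj (α k)) * polyStar (Φ k))

/-- `γ` is the sequence of deformed Verblunsky coefficients of `ν`. -/
def IsDeformedVerblunsky (ν : Measure ℝ) (γ : ℕ → ℂ) : Prop :=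
  ∃ α : ℕ → ℂ, IsVerblunsky ν α ∧
    ∀ k : ℕ, γ k = conj (α k) * ∏ j ∈ Finset.range k, (1 - conj (γ j)) / (1 - γ j)

/-- Symmetry of a measure on the circle (in angle coordinates): invariance under conjugation. -/
def SymmCircle (ν : Measure ℝ) : Prop :=
  (ν.map ctheta).map (starRingEnd ℂ) = ν.map ctheta

/-- The uniform measure on the circle, in angle coordinates. -/
def UNIFm : Measure ℝ :=
  volume.withDensity fun θ => ENNReal.ofReal (if 0 ≤ θ ∧ θ < 2*π then 1/(2*π) else 0)

end SumRules

namespace SumRules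

/-- Outlier contribution for the Killip–Simon sum rule (`+∞` inside `(-2,2)`). -/
def FSC (x : ℝ) : ℝ≥0∞ :=
  if 2 ≤ |x| then
    ENNReal.ofReal (|x|/2 * Real.sqrt (x^2 - 4) - 2 * Real.log ((|x| + Real.sqrt (x^2 - 4))/2))
  else ⊤

/-- Coefficient side of the Killip–Simon sum rule. -/
def IH (a b : ℕ → ℝ) : ℝ≥0∞ :=
  (1/2 : ℝ≥0∞) * ∑' k : ℕ, ENNReal.ofReal ((b (k+1))^2)
    + ∑' k : ℕ, ENNReal.ofReal (Gfun ((a (k+1))^2))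

def tauM (τ : ℝ) : ℝ := (1 - Real.sqrt τ)^2
def tauP (τ : ℝ) : ℝ := (1 + Real.sqrt τ)^2

/-- The Marchenko–Pastur law with parameter `τ`. -/
def MPm (τ : ℝ) : Measure ℝ :=
  volume.withDensity fun x =>
    ENNReal.ofReal (Real.sqrt ((x - tauM τ) * (tauP τ - x)) / (2*π*τ*x))

/-- Outlier contribution for the Marchenko–Pastur sum rule. -/
def FMP (τ : ℝ) (x : ℝ) : ℝ≥0∞ :=
  if tauP τ ≤ x then
    ENNReal.ofReal (∫ t in (tauP τ)..x, Real.sqrt ((t - tauP τ) * (t - tauM τ)) / (τ*t))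
  else if 0 < x ∧ x ≤ tauM τ then
    ENNReal.ofReal (∫ t in x..(tauM τ), Real.sqrt ((t - tauP τ) * (t - tauM τ)) / (τ*t))
  else ⊤

/-- Coefficient side of the Marchenko–Pastur sum rule. -/
def IL (τ : ℝ) (z : ℕ → ℝ) : ℝ≥0∞ :=
  ∑' k : ℕ, ENNReal.ofReal (τ⁻¹ * Gfun (z (2*k+1)) + Gfun (τ⁻¹ * z (2*k+2)))

def uPl (κ₁ κ₂ : ℝ) : ℝ :=
  2*(κ₂^2 - κ₁^2 + 4*Real.sqrt ((1+κ₁)*(1+κ₂)*(1+κ₁+κ₂)))/(2+κ₁+κ₂)^2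
def uMi (κ₁ κ₂ : ℝ) : ℝ :=
  2*(κ₂^2 - κ₁^2 - 4*Real.sqrt ((1+κ₁)*(1+κ₂)*(1+κ₁+κ₂)))/(2+κ₁+κ₂)^2

/-- The Kesten–McKay law with parameters `κ₁, κ₂`. -/
def KMKm (κ₁ κ₂ : ℝ) : Measure ℝ :=
  volume.withDensity fun x =>
    ENNReal.ofReal ((2+κ₁+κ₂)/(2*π) * Real.sqrt ((x - uMi κ₁ κ₂) * (uPl κ₁ κ₂ - x)) / (4 - x^2))

def ue (κ₁ κ₂ : ℝ) : ℝ := -(κ₁+κ₂)/(2+κ₁+κ₂)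
def uo (κ₁ κ₂ : ℝ) : ℝ := (κ₂-κ₁)/(2+κ₁+κ₂)

def He (κ₁ κ₂ u : ℝ) : ℝ :=
  -(1+κ₁+κ₂) * Real.log ((1-u)/(1 - ue κ₁ κ₂)) - Real.log ((1+u)/(1 + ue κ₁ κ₂))
def Ho (κ₁ κ₂ u : ℝ) : ℝ :=
  -(1+κ₁) * Real.log ((1-u)/(1 - uo κ₁ κ₂)) - (1+κ₂) * Real.log ((1+u)/(1 + uo κ₁ κ₂))

/-- Coefficient side of the Kesten–McKay sum rule. -/
def IJ (κ₁ κ₂ : ℝ) (u : ℕ → ℝ) : ℝ≥0∞ :=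
  ∑' k : ℕ, (ENNReal.ofReal (Ho κ₁ κ₂ (u (2*k+1))) + ENNReal.ofReal (He κ₁ κ₂ (u (2*k+2))))

/-- Outlier contribution for the Kesten–McKay sum rule. -/
def FKMK (κ₁ κ₂ : ℝ) (x : ℝ) : ℝ≥0∞ :=
  if uPl κ₁ κ₂ ≤ x then
    ENNReal.ofReal (∫ t in (uPl κ₁ κ₂)..x,
      (2+κ₁+κ₂) * Real.sqrt ((t - uPl κ₁ κ₂) * (t - uMi κ₁ κ₂)) / (4 - t^2))
  else if x ≤ uMi κ₁ κ₂ then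
    ENNReal.ofReal (∫ t in x..(uMi κ₁ κ₂),
      (2+κ₁+κ₂) * Real.sqrt ((t - uPl κ₁ κ₂) * (t - uMi κ₁ κ₂)) / (4 - t^2))
  else ⊤

def Hgw (g : ℝ) : ℝ := 1 - Real.sqrt (1 - g^2) + Real.log ((1 + Real.sqrt (1 - g^2))/2)

def thetaG (g : ℝ) : ℝ := 2 * Real.arcsin (Real.sqrt (1/|g|))

/-- The Gross–Witten measures, in angle coordinates. -/
def GWm (g : ℝ) : Measure ℝ :=
  if |g| ≤ 1 then
    volume.withDensity fun θ =>
      ENNReal.ofReal (if 0 ≤ θ ∧ θ < 2*π then (1 + g * Real.cos θ)/(2*π) else 0)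
  else if g < -1 then
    volume.withDensity fun θ => ENNReal.ofReal (
      if π - thetaG g ≤ θ ∧ θ ≤ π + thetaG g then
        |g| / π * Real.sin (θ/2) * Real.sqrt (Real.sin (θ/2)^2 - Real.cos (thetaG g/2)^2)
      else 0)
  else
    volume.withDensity fun θ => ENNReal.ofReal (
      if -thetaG g ≤ θ ∧ θ ≤ thetaG g then
        g/π * Real.cos (θ/2) * Real.sqrt (Real.sin (thetaG g/2)^2 - Real.sin (θ/2)^2)
      else 0)

def thetaD (d : ℝ) : ℝ := 2 * Real.arcsin (d/(1+d))
def gammaD (d : ℝ) : ℝ := -d/(1+d)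

/-- The Hua–Pickrell measure, in angle coordinates. -/
def HPm (d : ℝ) : Measure ℝ :=
  volume.withDensity fun θ => ENNReal.ofReal (
    if thetaD d < θ ∧ θ < 2*π - thetaD d then
      (1+d) * Real.sqrt (Real.sin (θ/2)^2 - Real.sin (thetaD d/2)^2) / (2*π*Real.sin (θ/2))
    else 0)

/-- The entropy-like function appearing in the Hua–Pickrell sum rule. -/
def HHP (d : ℝ) (γ : ℂ) : ℝ :=
  -Real.log ((1 - ‖γ‖^2)/(1 - (gammaD d)^2)) - 2*d*Real.log (‖1 - γ‖/(1 - gammaD d))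

/-- Outlier contribution for the Hua–Pickrell sum rule (in angle coordinates). -/
def FHP (d : ℝ) (θ : ℝ) : ℝ≥0∞ :=
  if θ ≤ thetaD d then
    ENNReal.ofReal (∫ φ in θ..(thetaD d),
      (1+d) * Real.sqrt (Real.sin (thetaD d/2)^2 - Real.sin (φ/2)^2) / Real.sin (φ/2))
  else if 2*π - thetaD d ≤ θ then
    ENNReal.ofReal (∫ φ in (2*π - thetaD d)..θ,
      (1+d) * Real.sqrt (Real.sin (thetaD d/2)^2 - Real.sin (φ/2)^2) / Real.sin (φ/2))
  else ⊤

/-- Set of outlying support points for a measure on the circle, in angle coordinates. -/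
def EST (ν : Measure ℝ) (tm tp : ℝ) : Set ℝ := suppSet ν \ Icc tm tp

/-- `ν ∈ 𝒮₁^𝕋(tm, tp)` (in angle coordinates). -/
def InS1T (ν : Measure ℝ) (tm tp : ℝ) : Prop := (EST ν tm tp).Countable

/-- The measure `𝒟(2,-2)`, with density `(1/2π)√((2-x)/(2+x))` on `(-2,2)`
(a shift of the hard-edge Marchenko–Pastur law). -/
def Dhard : Measure ℝ :=
  volume.withDensity fun x => ENNReal.ofReal (Real.sqrt ((2 - x)/(2 + x)) / (2*π))

/-- The mixture `μ_g = |g| 𝒟(2,-2) + (1-|g|) Arcsine`. -/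
def mugMix (g : ℝ) : Measure ℝ :=
  ENNReal.ofReal |g| • Dhard + ENNReal.ofReal (1 - |g|) • ArcsineM

/-- The mixture `ρ_g = |g| SC + (1-|g|) Arcsine`. -/
def rhog (g : ℝ) : Measure ℝ :=
  ENNReal.ofReal |g| • SCm + ENNReal.ofReal (1 - |g|) • ArcsineM

def Cg (g : ℝ) : ℝ :=
  -|g| * (1 - Real.log 2) + 1 - Real.sqrt (1 - g^2) + Real.log ((1 + Real.sqrt (1 - g^2))/2)

/-- The measure with density `(1/2π)(2+x)^{3/2}(2-x)^{1/2}` on `[-2,2]`. -/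
def muHat : Measure ℝ :=
  volume.withDensity fun x =>
    ENNReal.ofReal ((2 + x) * Real.sqrt (2 + x) * Real.sqrt (2 - x) / (2*π))

/-- The Poisson kernel measure `Pois(ζ)`, in angle coordinates. -/
def PoisM (ζ : ℂ) : Measure ℝ :=
  volume.withDensity fun θ => ENNReal.ofReal (
    if 0 ≤ θ ∧ θ < 2*π then (1 - ‖ζ‖^2)/(2*π*‖ctheta θ - ζ‖^2) else 0)

/-- The Carathéodory function of a measure on the circle (angle coordinates). -/
def Cara (ν : Measure ℝ) (z : ℂ) : ℂ := ∫ θ, (ctheta θ + z)/(ctheta θ - z) ∂ν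

/-- `f` is the Schur function of `ν`. -/
def IsSchurFn (ν : Measure ℝ) (f : ℂ → ℂ) : Prop :=
  DifferentiableOn ℂ f (Metric.ball 0 1) ∧
  (∀ z ∈ Metric.ball (0:ℂ) 1, ‖f z‖ ≤ 1) ∧
  (∀ z ∈ Metric.ball (0:ℂ) 1, Cara ν z - 1 = z * f z * (Cara ν z + 1))

/-- Möbius transform of the unit disk. -/
def mtrans (ρ z : ℂ) : ℂ := (z - ρ)/(1 - conj ρ * z)

def npRaw (ρ : ℂ) (g : ℂ → ℂ) (z : ℂ) : ℂ :=
  ((-ρ/(‖ρ‖ : ℂ)) / mtrans ρ z) * ((g z - g ρ)/(1 - conj (g ρ) * g z))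

-- One step of the Nevanlinna–Pick algorithm at `ρ` (the removable singularity at `ρ`
-- is filled in by the limit).
open Classical in
def npStep (ρ : ℂ) (g : ℂ → ℂ) : ℂ → ℂ := fun z =>
  if z = ρ then limUnder (𝓝[≠] ρ) (npRaw ρ g) else npRaw ρ g z

def schurRaw (g : ℂ → ℂ) (z : ℂ) : ℂ := ((g z - g 0)/z)/(1 - conj (g 0) * g z)

-- One step of the classical Schur algorithm (the removable singularity at `0`
-- is filled in by the limit).
open Classical in
def schurStep (g : ℂ → ℂ) : ℂ → ℂ := fun z =>
  if z = 0 then limUnder (𝓝[≠] (0:ℂ)) (schurRaw g) else schurRaw g z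

def xdHP (d : ℝ) : ℝ := 2*(1 + 2*d - d^2)/(1+d)^2

def uKMK (d : ℝ) : ℝ := 2*Real.sqrt (1 + 2*d)/(1+d)

end SumRules

namespace SumRules


lemma KLdiv_eq_klDiv (ν μ : Measure ℝ) [IsProbabilityMeasure ν] [IsProbabilityMeasure μ] :
    KLdiv ν μ = InformationTheory.klDiv ν μ := by
  unfold KLdiv
  split_ifs with h
  · rw [InformationTheory.klDiv_of_ac_of_integrable h.1 h.2]
    simp
  · symm
    rw [InformationTheory.klDiv_eq_top_iff]
    tauto

lemma dv_lower (σ μ : Measure ℝ) [IsProbabilityMeasure σ] [IsProbabilityMeasure μ]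
    (f : ℝ → ℝ) (hf : Integrable f σ) (hf2 : Integrable (fun x => exp (f x)) μ) :
    ENNReal.ofReal (∫ x, f x ∂σ - log (∫ x, exp (f x) ∂μ)) ≤ KLdiv σ μ := by
  unfold KLdiv
  split_ifs with h
  · apply ENNReal.ofReal_le_ofReal
    have h1 := integral_llr_tilted_right h.1 hf hf2 h.2
    have hac : σ ≪ μ.tilted f := h.1.trans (absolutelyContinuous_tilted hf2)
    have hint : Integrable (llr σ (μ.tilted f)) σ := integrable_llr_tilted_right h.1 hf h.2 hf2
    have : IsProbabilityMeasure (μ.tilted f) := isProbabilityMeasure_tilted hf2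
    have h2 := InformationTheory.integral_llr_add_sub_measure_univ_nonneg hac hint
    simp at h2
    linarith
  · exact le_top

lemma integrable_of_bdd (σ : Measure ℝ) [IsProbabilityMeasure σ] {f : ℝ → ℝ} (hf : Measurable f)
    (C : ℝ) (h : ∀ᵐ x ∂σ, |f x| ≤ C) : Integrable f σ :=
  Integrable.of_bound hf.aestronglyMeasurable C h

lemma kl_cont (σ μ : Measure ℝ) [IsProbabilityMeasure σ] [IsProbabilityMeasure μ]
    (hσ : ∀ᵐ x ∂σ, x ∈ Icc (-2 : ℝ) 2) (hμ : ∀ᵐ x ∂μ, x ∈ Icc (-2 : ℝ) 2) (S : ℝ)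
    (h : ∀ p : ℝ[X], (∀ x ∈ Icc (-2 : ℝ) 2, 0 < p.eval x) →
      ∫ x, log (p.eval x) ∂σ ≤ S + ∫ x, p.eval x ∂μ - 1)
    (f : ℝ → ℝ) (hf : Continuous f) (δ M : ℝ) (hδ : 0 < δ) (hfδ : ∀ x, δ ≤ f x)
    (hM : ∀ x, f x ≤ M) :
    ∫ x, log (f x) ∂σ ≤ S + ∫ x, f x ∂μ - 1 := by
  apply le_of_forall_pos_le_add
  intro ε hε
  obtain ⟨q, hq⟩ := exists_polynomial_near_of_continuousOn (-2) 2 f hf.continuousOn (ε/2) (by positivity)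
  set p : ℝ[X] := q + C (ε/2) with hp
  have hpe : ∀ x, p.eval x = q.eval x + ε/2 := by intro x; simp [hp]
  have h1 : ∀ x ∈ Icc (-2 : ℝ) 2, f x ≤ p.eval x ∧ p.eval x ≤ f x + ε := by
    intro x hx
    have := abs_lt.1 (hq x hx)
    rw [hpe]; constructor <;> linarith
  have h2 := h p (fun x hx => hδ.trans_le ((hfδ x).trans (h1 x hx).1))
  have hpc : Continuous fun x => p.eval x := p.continuous
  have hif : ∀ (τ : Measure ℝ) [IsProbabilityMeasure τ], Integrable f τ := by
    intro τ _
    refine integrable_of_bdd τ hf.measurable M (Eventually.of_forall fun x => ?_)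
    rw [abs_of_pos (hδ.trans_le (hfδ x))]; exact hM x
  have hip : Integrable (fun x => p.eval x) μ := by
    refine integrable_of_bdd μ hpc.measurable (M + ε) ?_
    filter_upwards [hμ] with x hx
    have := h1 x hx
    rw [abs_of_pos (by linarith [hfδ x])]; linarith [hM x]
  have hlb : ∀ y, δ ≤ y → y ≤ M + ε → |log y| ≤ |log δ| + |log (M+ε)| := by
    intro y h1 h2
    have a := log_le_log hδ h1
    have b := log_le_log (hδ.trans_le h1) h2
    rw [abs_le]
    constructor
    · linarith [neg_abs_le (log δ), abs_nonneg (log (M+ε))]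
    · linarith [le_abs_self (log (M+ε)), abs_nonneg (log δ)]
  have h3 : ∫ x, log (f x) ∂σ ≤ ∫ x, log (p.eval x) ∂σ := by
    apply integral_mono_ae
    · refine integrable_of_bdd σ (measurable_log.comp hf.measurable) (|log δ| + |log (M+ε)|) ?_
      exact Eventually.of_forall fun x => hlb _ (hfδ x) (by linarith [hM x])
    · refine integrable_of_bdd σ (measurable_log.comp hpc.measurable) (|log δ| + |log (M+ε)|) ?_
      filter_upwards [hσ] with x hx
      have := h1 x hx
      exact hlb _ (by linarith [hfδ x]) (by linarith [hM x])
    · filter_upwards [hσ] with x hx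
      exact log_le_log (hδ.trans_le (hfδ x)) (h1 x hx).1
  have h4 : ∫ x, p.eval x ∂μ ≤ ∫ x, f x ∂μ + ε := by
    have : ∫ x, p.eval x ∂μ ≤ ∫ x, (f x + ε) ∂μ := by
      apply integral_mono_ae hip ((hif μ).add (integrable_const _))
      filter_upwards [hμ] with x hx
      exact (h1 x hx).2
    rw [integral_add (hif μ) (integrable_const _)] at this
    simpa using this
  linarith

lemma kl_meas (σ μ : Measure ℝ) [IsProbabilityMeasure σ] [IsProbabilityMeasure μ]
    (hσ : ∀ᵐ x ∂σ, x ∈ Icc (-2 : ℝ) 2) (hμ : ∀ᵐ x ∂μ, x ∈ Icc (-2 : ℝ) 2) (S : ℝ)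
    (h : ∀ p : ℝ[X], (∀ x ∈ Icc (-2 : ℝ) 2, 0 < p.eval x) →
      ∫ x, log (p.eval x) ∂σ ≤ S + ∫ x, p.eval x ∂μ - 1)
    (f : ℝ → ℝ) (hf : Measurable f) (δ M : ℝ) (hδ : 0 < δ) (hfδ : ∀ x, δ ≤ f x)
    (hM : ∀ x, f x ≤ M) :
    ∫ x, log (f x) ∂σ ≤ S + ∫ x, f x ∂μ - 1 := by
  apply le_of_forall_pos_le_add
  intro ε hε
  have hif : ∀ (τ : Measure ℝ) [IsFiniteMeasure τ], Integrable f τ := by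
    intro τ _
    refine Integrable.of_bound hf.aestronglyMeasurable M (Eventually.of_forall fun x => ?_)
    rw [Real.norm_eq_abs, abs_of_pos (hδ.trans_le (hfδ x))]; exact hM x
  set η := ε / (1 + 1/δ) with hη
  have hηpos : 0 < η := by positivity
  obtain ⟨g₀, hg₀, hg₀i⟩ := (hif (σ + μ)).exists_boundedContinuous_integral_sub_le hηpos
  set g : ℝ → ℝ := fun x => max (g₀ x) δ with hg
  have hgc : Continuous g := g₀.continuous.max continuous_const
  have hgM : ∀ x, g x ≤ max ‖g₀‖ δ := fun x =>
    max_le_max ((le_abs_self _).trans (g₀.norm_coe_le_norm x)) le_rfl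
  have hgδ : ∀ x, δ ≤ g x := fun x => le_max_right _ _
  have key := kl_cont σ μ hσ hμ S h g hgc δ _ hδ hgδ hgM
  have hd : ∀ x, |f x - g x| ≤ ‖f x - g₀ x‖ := by
    intro x
    rw [Real.norm_eq_abs]
    simp only [hg]
    rcases le_total (g₀ x) δ with h1 | h1
    · rw [max_eq_right h1, abs_of_nonneg (by linarith [hfδ x]), abs_of_nonneg (by linarith [hfδ x])]
      linarith
    · rw [max_eq_left h1]
  have hid : Integrable (fun x => ‖f x - g₀ x‖) (σ + μ) := ((hif _).sub hg₀i).norm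
  have hid1 := hid.left_of_add_measure
  have hid2 := hid.right_of_add_measure
  rw [integral_add_measure hid1 hid2] at hg₀
  have n1 : 0 ≤ ∫ x, ‖f x - g₀ x‖ ∂σ := integral_nonneg fun x => norm_nonneg _
  have n2 : 0 ≤ ∫ x, ‖f x - g₀ x‖ ∂μ := integral_nonneg fun x => norm_nonneg _
  have hig : Integrable g μ := by
    refine integrable_of_bdd μ hgc.measurable (max ‖g₀‖ δ) (Eventually.of_forall fun x => ?_)
    rw [abs_of_pos (hδ.trans_le (hgδ x))]; exact hgM x
  have hlb : ∀ y K, δ ≤ y → y ≤ K → |log y| ≤ |log δ| + |log K| := by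
    intro y K h1 h2
    have a := log_le_log hδ h1
    have b := log_le_log (hδ.trans_le h1) h2
    rw [abs_le]
    constructor
    · linarith [neg_abs_le (log δ), abs_nonneg (log K)]
    · linarith [le_abs_self (log K), abs_nonneg (log δ)]
  have hilf : Integrable (fun x => log (f x)) σ :=
    integrable_of_bdd σ (measurable_log.comp hf) _
      (Eventually.of_forall fun x => hlb _ M (hfδ x) (hM x))
  have hilg : Integrable (fun x => log (g x)) σ :=
    integrable_of_bdd σ (measurable_log.comp hgc.measurable) _
      (Eventually.of_forall fun x => hlb _ _ (hgδ x) (hgM x))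
  have e1 : ∫ x, log (f x) ∂σ ≤ ∫ x, log (g x) ∂σ + (1/δ) * η := by
    have : ∫ x, log (f x) ∂σ ≤ ∫ x, (log (g x) + (1/δ) * ‖f x - g₀ x‖) ∂σ := by
      apply integral_mono hilf (hilg.add (hid1.const_mul _))
      intro x
      have gp := hδ.trans_le (hgδ x)
      have fp := hδ.trans_le (hfδ x)
      have h1 := log_le_sub_one_of_pos (div_pos fp gp)
      rw [log_div fp.ne' gp.ne'] at h1
      have h2 : f x / g x - 1 ≤ (1/δ) * ‖f x - g₀ x‖ := by
        have : f x / g x - 1 = (1 / g x) * (f x - g x) := by field_simp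
        rw [this]
        have h3 : (1 / g x) ≤ 1/δ := one_div_le_one_div_of_le hδ (hgδ x)
        calc (1 / g x) * (f x - g x) ≤ (1 / g x) * |f x - g x| := by
              gcongr; exact le_abs_self _
          _ ≤ (1/δ) * ‖f x - g₀ x‖ := by
              gcongr; exact hd x
      show log (f x) ≤ log (g x) + (1/δ) * ‖f x - g₀ x‖
      linarith
    rw [integral_add hilg (hid1.const_mul _), integral_const_mul] at this
    have : (1/δ) * ∫ x, ‖f x - g₀ x‖ ∂σ ≤ (1/δ) * η := by gcongr; linarith
    linarith
  have e2 : ∫ x, g x ∂μ ≤ ∫ x, f x ∂μ + η := by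
    have : ∫ x, g x ∂μ ≤ ∫ x, (f x + ‖f x - g₀ x‖) ∂μ := by
      apply integral_mono hig ((hif μ).add hid2)
      intro x
      have := hd x
      have := neg_abs_le (f x - g x)
      show g x ≤ f x + ‖f x - g₀ x‖
      linarith
    rw [integral_add (hif μ) hid2] at this
    linarith
  have : (1/δ) * η + η = ε := by rw [hη]; field_simp; ring
  linarith

lemma kl_ac (σ μ : Measure ℝ) [IsProbabilityMeasure σ] [IsProbabilityMeasure μ]
    (hσ : ∀ᵐ x ∂σ, x ∈ Icc (-2 : ℝ) 2) (hμ : ∀ᵐ x ∂μ, x ∈ Icc (-2 : ℝ) 2) (S : ℝ)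
    (h : ∀ p : ℝ[X], (∀ x ∈ Icc (-2 : ℝ) 2, 0 < p.eval x) →
      ∫ x, log (p.eval x) ∂σ ≤ S + ∫ x, p.eval x ∂μ - 1) : σ ≪ μ := by
  refine Measure.AbsolutelyContinuous.mk fun A hA hA0 => ?_
  by_contra hne
  have hpos : 0 < σ.real A := by
    rw [measureReal_def]
    exact ENNReal.toReal_pos hne (measure_ne_top _ _)
  have key : ∀ M : ℝ, 0 ≤ M → σ.real A * M ≤ S := by
    intro M hM
    have h1 := kl_meas σ μ hσ hμ S h (fun x => A.indicator (fun _ => exp M - 1) x + 1)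
      ((measurable_const.indicator hA).add_const 1) 1 (exp M) one_pos
      (fun x => by
        have : 0 ≤ A.indicator (fun _ => exp M - 1) x :=
          indicator_nonneg (fun _ _ => by linarith [one_le_exp hM]) x
        linarith)
      (fun x => by
        by_cases hx : x ∈ A
        · simp [hx]
        · simp [hx, one_le_exp hM])
    have e1 : ∫ x, (A.indicator (fun _ => exp M - 1) x + 1) ∂μ = 1 := by
      rw [integral_add ((integrable_const _).indicator hA) (integrable_const _),
        integral_indicator_const _ hA]
      simp [measureReal_def, hA0]
    have e2 : ∀ x, log (A.indicator (fun _ => exp M - 1) x + 1) = A.indicator (fun _ => M) x := by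
      intro x
      by_cases hx : x ∈ A
      · simp [hx]
      · simp [hx]
    simp_rw [e2] at h1
    rw [integral_indicator_const _ hA, e1] at h1
    simp only [smul_eq_mul] at h1
    linarith
  have h2 := key ((|S| + 1) / σ.real A) (by positivity)
  rw [mul_div_cancel₀ _ hpos.ne'] at h2
  linarith [le_abs_self S]

lemma kl_upper (σ μ : Measure ℝ) [IsProbabilityMeasure σ] [IsProbabilityMeasure μ]
    (hσ : ∀ᵐ x ∂σ, x ∈ Icc (-2 : ℝ) 2) (hμ : ∀ᵐ x ∂μ, x ∈ Icc (-2 : ℝ) 2) (S : ℝ)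
    (h : ∀ p : ℝ[X], (∀ x ∈ Icc (-2 : ℝ) 2, 0 < p.eval x) →
      ∫ x, log (p.eval x) ∂σ ≤ S + ∫ x, p.eval x ∂μ - 1) : KLdiv σ μ ≤ ENNReal.ofReal S := by
  have hac := kl_ac σ μ hσ hμ S h
  rw [KLdiv_eq_klDiv, InformationTheory.klDiv_eq_lintegral_klFun_of_ac hac]
  set g : ℝ → ℝ := fun x => (σ.rnDeriv μ x).toReal with hg
  have hgm : Measurable g := (Measure.measurable_rnDeriv σ μ).ennreal_toReal
  have hg0 : ∀ x, 0 ≤ g x := fun x => ENNReal.toReal_nonneg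
  have hgi : Integrable g μ := Measure.integrable_toReal_rnDeriv
  let d : ℕ → ℝ := fun n => 1 / ((n:ℝ) + 1)
  have hd0 : ∀ n, 0 < d n := fun n => by positivity
  have hd1 : ∀ n, d n ≤ 1 := fun n => by
    simp only [d]; rw [div_le_one (by positivity)]; linarith [Nat.cast_nonneg (α := ℝ) n]
  let f : ℕ → ℝ → ℝ := fun n x => max (d n) (min ((n:ℝ) + 1) (g x))
  have hfm : ∀ n, Measurable (f n) := fun n => by fun_prop
  have hfd : ∀ n x, d n ≤ f n x := fun n x => le_max_left _ _
  have hfM : ∀ n x, f n x ≤ (n:ℝ) + 1 := fun n x =>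
    max_le ((hd1 n).trans (by linarith [Nat.cast_nonneg (α := ℝ) n])) (min_le_left _ _)
  have hfp : ∀ n x, 0 < f n x := fun n x => (hd0 n).trans_le (hfd n x)
  let k : ℕ → ℝ → ℝ := fun n x => g x * log (f n x) - f n x + 1
  have hk0 : ∀ n x, 0 ≤ k n x := by
    intro n x
    have hkl : 0 ≤ f n x * log (f n x) + 1 - f n x :=
      InformationTheory.klFun_nonneg (hfp n x).le
    have : f n x * log (f n x) ≤ g x * log (f n x) := by
      rcases lt_trichotomy (f n x) (g x) with h1 | h1 | h1
      · have : 0 ≤ log (f n x) := by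
          apply log_nonneg
          by_contra hlt
          push Not at hlt
          have h3 : min ((n:ℝ)+1) (g x) ≤ f n x := le_max_right _ _
          have h4 : min ((n:ℝ)+1) (g x) = g x := by
            apply min_eq_right
            by_contra h5
            push Not at h5
            rw [min_eq_left h5.le] at h3
            linarith [Nat.cast_nonneg (α := ℝ) n]
          rw [h4] at h3
          linarith
        exact mul_le_mul_of_nonneg_right h1.le this
      · rw [h1]
      · have : log (f n x) ≤ 0 := by
          apply log_nonpos (hfp n x).le
          have : f n x = d n := by
            apply max_eq_left
            by_contra h3
            push Not at h3
            have h4 : f n x = min ((n:ℝ)+1) (g x) := max_eq_right h3.le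
            have := min_le_right ((n:ℝ)+1) (g x)
            linarith
          rw [this]; exact hd1 n
        exact mul_le_mul_of_nonpos_right h1.le this
    show 0 ≤ g x * log (f n x) - f n x + 1
    linarith
  have hlim : ∀ x, Tendsto (fun n => k n x) atTop (𝓝 (InformationTheory.klFun (g x))) := by
    intro x
    have hdlim : Tendsto d atTop (𝓝 0) := tendsto_one_div_add_atTop_nhds_zero_nat
    have hflim : Tendsto (fun n => f n x) atTop (𝓝 (g x)) := by
      have : Tendsto (fun n => max (d n) (g x)) atTop (𝓝 (max 0 (g x))) :=
        hdlim.max tendsto_const_nhds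
      rw [max_eq_right (hg0 x)] at this
      refine this.congr' ?_
      filter_upwards [eventually_ge_atTop ⌈g x⌉₊] with n hn
      have : g x ≤ n := Nat.ceil_le.1 hn
      simp only [f]
      rw [min_eq_right (by linarith)]
    rcases (hg0 x).eq_or_lt with h0 | h0
    · have e : ∀ n, k n x = - f n x + 1 := fun n => by simp only [k, ← h0]; ring
      simp_rw [e]
      have := hflim.neg.add_const 1
      rw [← h0] at this ⊢
      simpa [InformationTheory.klFun] using this
    · have := ((hflim.log h0.ne').const_mul (g x)).sub hflim |>.add_const 1
      convert this using 2
      simp [InformationTheory.klFun]; ring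
  have hkint : ∀ n, ∫⁻ x, ENNReal.ofReal (k n x) ∂μ ≤ ENNReal.ofReal S := by
    intro n
    have hlb : ∀ x, |log (f n x)| ≤ |log (d n)| + |log ((n:ℝ)+1)| := by
      intro x
      have a := log_le_log (hd0 n) (hfd n x)
      have b := log_le_log (hfp n x) (hfM n x)
      rw [abs_le]
      constructor
      · linarith [neg_abs_le (log (d n)), abs_nonneg (log ((n:ℝ)+1))]
      · linarith [le_abs_self (log ((n:ℝ)+1)), abs_nonneg (log (d n))]
    have i1 : Integrable (fun x => g x * log (f n x)) μ := by
      refine hgi.mul_bdd (c := |log (d n)| + |log ((n:ℝ)+1)|) ?_ ?_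
      · exact (measurable_log.comp (hfm n)).aestronglyMeasurable
      · exact Eventually.of_forall hlb
    have i2 : Integrable (f n) μ :=
      integrable_of_bdd μ (hfm n) ((n:ℝ)+1) (Eventually.of_forall fun x => by
        rw [abs_of_pos (hfp n x)]; exact hfM n x)
    have hki : Integrable (k n) μ := (i1.sub i2).add (integrable_const 1)
    rw [← ofReal_integral_eq_lintegral_ofReal hki (Eventually.of_forall (hk0 n))]
    apply ENNReal.ofReal_le_ofReal
    have e : ∫ x, k n x ∂μ = ∫ x, log (f n x) ∂σ - ∫ x, f n x ∂μ + 1 := by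
      simp only [k]
      have i12 : Integrable (fun x => g x * log (f n x) - f n x) μ := i1.sub i2
      rw [integral_add i12 (integrable_const 1), integral_sub i1 i2,
        ← integral_toReal_rnDeriv_mul hac]
      simp [hg]
    rw [e]
    have := kl_meas σ μ hσ hμ S h (f n) (hfm n) (d n) _ (hd0 n) (hfd n) (hfM n)
    linarith
  calc ∫⁻ x, ENNReal.ofReal (InformationTheory.klFun (g x)) ∂μ
      = ∫⁻ x, liminf (fun n => ENNReal.ofReal (k n x)) atTop ∂μ := by
        apply lintegral_congr
        intro x
        exact (ENNReal.tendsto_ofReal (hlim x)).liminf_eq.symm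
    _ ≤ liminf (fun n => ∫⁻ x, ENNReal.ofReal (k n x) ∂μ) atTop := by
        apply lintegral_liminf_le
        intro n
        exact ENNReal.measurable_ofReal.comp
          (((hgm.mul (measurable_log.comp (hfm n))).sub (hfm n)).add_const 1)
    _ ≤ ENNReal.ofReal S := by
        refine (liminf_le_liminf (Eventually.of_forall hkint)).trans ?_
        simp


/-- Szego recursion with coefficients `u`. -/
def szAB (u : ℕ → ℝ) : ℕ → ℂ[X] × ℂ[X]
  | 0 => (1, 1)
  | n + 1 => (X * (szAB u n).1 - C (u (n+1) : ℂ) * (szAB u n).2,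
      (szAB u n).2 - C (u (n+1) : ℂ) * (X * (szAB u n).1))

def fA (u : ℕ → ℝ) (n : ℕ) (z : ℂ) : ℂ := (szAB u n).1.eval z
def fB (u : ℕ → ℝ) (n : ℕ) (z : ℂ) : ℂ := (szAB u n).2.eval z

lemma fA_zero (u : ℕ → ℝ) (z : ℂ) : fA u 0 z = 1 := by simp [fA, szAB]
lemma fB_zero (u : ℕ → ℝ) (z : ℂ) : fB u 0 z = 1 := by simp [fB, szAB]
lemma fA_succ (u : ℕ → ℝ) (n : ℕ) (z : ℂ) :
    fA u (n+1) z = z * fA u n z - u (n+1) * fB u n z := by simp [fA, fB, szAB]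
lemma fB_succ (u : ℕ → ℝ) (n : ℕ) (z : ℂ) :
    fB u (n+1) z = fB u n z - u (n+1) * (z * fA u n z) := by simp [fA, fB, szAB]

lemma fA_cont (u : ℕ → ℝ) (n : ℕ) : Continuous (fA u n) := (szAB u n).1.continuous
lemma fB_cont (u : ℕ → ℝ) (n : ℕ) : Continuous (fB u n) := (szAB u n).2.continuous
lemma fB_diff (u : ℕ → ℝ) (n : ℕ) : Differentiable ℂ (fB u n) := (szAB u n).2.differentiable

lemma fB_at_zero (u : ℕ → ℝ) (n : ℕ) : fB u n 0 = 1 := by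
  induction n with
  | zero => exact fB_zero u 0
  | succ n ih => rw [fB_succ, ih]; simp

lemma sz_deg (u : ℕ → ℝ) (n : ℕ) : (szAB u n).1.natDegree ≤ n ∧ (szAB u n).2.natDegree ≤ n := by
  induction n with
  | zero => simp [szAB]
  | succ n ih =>
    have hX : (X * (szAB u n).1).natDegree ≤ n + 1 := by
      refine natDegree_mul_le.trans ?_
      have := ih.1
      have := natDegree_X_le (R := ℂ)
      omega
    constructor
    · refine (natDegree_sub_le _ _).trans (max_le hX ?_)
      exact (natDegree_C_mul_le _ _).trans (by omega)
    · refine (natDegree_sub_le _ _).trans (max_le (by omega) ?_)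
      exact (natDegree_C_mul_le _ _).trans hX

lemma fB_ne (u : ℕ → ℝ) (hu : ∀ k, u (k+1) ∈ Ioo (-1 : ℝ) 1) (n : ℕ) (z : ℂ) (hz : ‖z‖ ≤ 1) :
    fB u n z ≠ 0 ∧ ‖fA u n z‖ ≤ ‖fB u n z‖ := by
  induction n with
  | zero => simp [fA_zero, fB_zero]
  | succ n ih =>
    obtain ⟨h1, h2⟩ := ih
    have hua : |u (n+1)| < 1 := abs_lt.2 (hu n)
    have hB : 0 < ‖fB u n z‖ := norm_pos_iff.2 h1
    have hzA : ‖z * fA u n z‖ ≤ ‖fB u n z‖ := by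
      rw [norm_mul]
      calc ‖z‖ * ‖fA u n z‖ ≤ 1 * ‖fB u n z‖ := by gcongr
        _ = _ := one_mul _
    constructor
    · rw [fB_succ]
      intro h0
      have e : fB u n z = u (n+1) * (z * fA u n z) := sub_eq_zero.1 h0
      have : ‖fB u n z‖ ≤ |u (n+1)| * ‖fB u n z‖ := by
        calc ‖fB u n z‖ = |u (n+1)| * ‖z * fA u n z‖ := by
              conv_lhs => rw [e]
              rw [norm_mul, Complex.norm_real, Real.norm_eq_abs]
          _ ≤ _ := by gcongr
      nlinarith
    · rw [fA_succ, fB_succ]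
      generalize z * fA u n z = a at *
      generalize fB u n z = b at *
      generalize u (n+1) = t at *
      rw [← sq_le_sq₀ (norm_nonneg _) (norm_nonneg _), ← Complex.normSq_eq_norm_sq,
        ← Complex.normSq_eq_norm_sq]
      rw [← sq_le_sq₀ (norm_nonneg _) (norm_nonneg _), ← Complex.normSq_eq_norm_sq,
        ← Complex.normSq_eq_norm_sq] at hzA
      simp only [Complex.normSq_apply, Complex.sub_re, Complex.sub_im, Complex.mul_re,
        Complex.mul_im, Complex.ofReal_re, Complex.ofReal_im] at *
      have : t^2 < 1 := by rw [← sq_abs]; nlinarith [abs_nonneg t]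
      nlinarith

lemma f_circle (u : ℕ → ℝ) (n : ℕ) (z : ℂ) (hz : z * conj z = 1) :
    fA u n z = z ^ n * conj (fB u n z) ∧ fB u n z = z ^ n * conj (fA u n z) := by
  induction n with
  | zero => simp [fA_zero, fB_zero]
  | succ n ih =>
    obtain ⟨h1, h2⟩ := ih
    rw [fA_succ, fB_succ]
    simp only [map_sub, map_mul, Complex.conj_ofReal, pow_succ]
    constructor
    · linear_combination z * h1 - u (n+1) * h2 + u (n+1) * z^n * conj (fA u n z) * hz
    · linear_combination h2 - u (n+1) * z * h1 - z^n * conj (fA u n z) * hz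

lemma f_normsq (u : ℕ → ℝ) (n : ℕ) (z : ℂ) (hz : z * conj z = 1) :
    fA u n z * conj (fA u n z) = fB u n z * conj (fB u n z) := by
  obtain ⟨h1, h2⟩ := f_circle u n z hz
  calc fA u n z * conj (fA u n z) = (z ^ n * conj (fB u n z)) * conj (fA u n z) := by rw [← h1]
    _ = (z ^ n * conj (fA u n z)) * conj (fB u n z) := by ring
    _ = _ := by rw [← h2]

lemma circ_mul {z : ℂ} (hz : z ∈ Metric.sphere (0:ℂ) |1|) : z * conj z = 1 := by
  have : ‖z‖ = 1 := by simpa using hz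
  rw [Complex.mul_conj, Complex.normSq_eq_norm_sq, this]; simp

def EE (u : ℕ → ℝ) (N : ℕ) (h : ℂ → ℂ) : ℂ :=
  Real.circleAverage (fun z => h z / (fB u N z * conj (fB u N z))) 0 1



lemma EE_congr (u : ℕ → ℝ) (N : ℕ) {h₁ h₂ : ℂ → ℂ} (h : ∀ z, z * conj z = 1 → h₁ z = h₂ z) :
    EE u N h₁ = EE u N h₂ := by
  unfold EE
  apply Real.circleAverage_congr_sphere
  intro z hz
  simp only
  rw [h z (circ_mul hz)]

lemma EE_int (u : ℕ → ℝ) (hu : ∀ k, u (k+1) ∈ Ioo (-1 : ℝ) 1) (N : ℕ) {h : ℂ → ℂ} (hc : Continuous h) :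
    CircleIntegrable (fun z => h z / (fB u N z * conj (fB u N z))) 0 1 := by
  apply ContinuousOn.circleIntegrable'
  apply ContinuousOn.div hc.continuousOn
  · exact ((fB_cont u N).mul (Complex.continuous_conj.comp (fB_cont u N))).continuousOn
  · intro z hz
    have : ‖z‖ = 1 := by simpa using hz
    have := (fB_ne u hu N z this.le).1
    exact mul_ne_zero this ((_root_.map_ne_zero _).2 this)

lemma EE_add (u : ℕ → ℝ) (hu : ∀ k, u (k+1) ∈ Ioo (-1 : ℝ) 1) (N : ℕ) {h₁ h₂ : ℂ → ℂ} (c₁ : Continuous h₁) (c₂ : Continuous h₂) :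
    EE u N (fun z => h₁ z + h₂ z) = EE u N h₁ + EE u N h₂ := by
  unfold EE
  rw [← Real.circleAverage_fun_add (EE_int u hu N c₁) (EE_int u hu N c₂)]
  simp_rw [add_div]

lemma EE_smul (u : ℕ → ℝ) (N : ℕ) (a : ℂ) (h : ℂ → ℂ) :
    EE u N (fun z => a * h z) = a * EE u N h := by
  unfold EE
  rw [← smul_eq_mul, ← Real.circleAverage_fun_smul]
  simp_rw [smul_eq_mul, mul_div_assoc]

lemma EE_sum (u : ℕ → ℝ) (hu : ∀ k, u (k+1) ∈ Ioo (-1 : ℝ) 1) (N : ℕ) {ι : Type*} (s : Finset ι) {h : ι → ℂ → ℂ} (c : ∀ i, Continuous (h i)) :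
    EE u N (fun z => ∑ i ∈ s, h i z) = ∑ i ∈ s, EE u N (h i) := by
  unfold EE
  rw [← Real.circleAverage_fun_sum (fun i _ => EE_int u hu N (c i))]
  simp_rw [Finset.sum_div]

lemma EE_mean (u : ℕ → ℝ) (hu : ∀ k, u (k+1) ∈ Ioo (-1 : ℝ) 1) (N : ℕ) (j : ℕ) : Real.circleAverage (fun z => z ^ j / fB u N z) 0 1 = (0:ℂ)^j := by
  have h := circleAverage_of_differentiable_on_off_countable (s := ∅) (f := fun z => z ^ j / fB u N z)
    (c := 0) (R := 1) countable_empty ?_ ?_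
  · rw [h, fB_at_zero]; simp
  · apply ContinuousOn.div (by fun_prop) (fB_cont u N).continuousOn
    intro z hz
    exact (fB_ne u hu N z (by simpa using hz)).1
  · intro z hz
    have hz' : ‖z‖ ≤ 1 := by
      have := hz.1
      simp at this
      exact this.le
    exact (differentiableAt_pow j).div (fB_diff u N z) (fB_ne u hu N z hz').1

lemma EE_top_A (u : ℕ → ℝ) (hu : ∀ k, u (k+1) ∈ Ioo (-1 : ℝ) 1) (N : ℕ) (j : ℕ) (hj : j < N) : EE u N (fun z => conj z ^ j * fA u N z) = 0 := by
  have := EE_mean u hu N (N - j)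
  rw [zero_pow (by omega)] at this
  rw [← this]
  apply Real.circleAverage_congr_sphere
  intro z hz
  have hn : ‖z‖ = 1 := by simpa using hz
  have hz := circ_mul hz
  have hB := (fB_ne u hu N z hn.le).1
  have hB' : conj (fB u N z) ≠ 0 := (_root_.map_ne_zero _).2 hB
  simp only
  rw [(f_circle u N z hz).1]
  have e : conj z ^ j * z ^ N = z ^ (N - j) := by
    conv_lhs => rw [← Nat.sub_add_cancel hj.le, pow_add, mul_comm, mul_assoc, ← mul_pow, hz, one_pow, mul_one]
  rw [← e]
  field_simp

lemma EE_top_B (u : ℕ → ℝ) (hu : ∀ k, u (k+1) ∈ Ioo (-1 : ℝ) 1) (N : ℕ) (j : ℕ) : EE u N (fun z => conj z ^ j * fB u N z) = (0:ℂ)^j := by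
  have h1 := EE_mean u hu N j
  have hci : CircleIntegrable (fun z => z ^ j / fB u N z) 0 1 := by
    apply ContinuousOn.circleIntegrable'
    apply ContinuousOn.div (by fun_prop) (fB_cont u N).continuousOn
    intro z hz
    have hn : ‖z‖ = 1 := by simpa using hz
    exact (fB_ne u hu N z hn.le).1
  have h2 := (Complex.conjCLE : ℂ →L[ℝ] ℂ).circleAverage_comp_comm hci
  rw [h1] at h2
  have h3 : (Complex.conjCLE : ℂ →L[ℝ] ℂ) ((0:ℂ)^j) = (0:ℂ)^j := by simp
  rw [h3] at h2
  rw [← h2]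
  apply Real.circleAverage_congr_sphere
  intro z hz
  have hn : ‖z‖ = 1 := by simpa using hz
  have hB := (fB_ne u hu N z hn.le).1
  have hB' : conj (fB u N z) ≠ 0 := (_root_.map_ne_zero _).2 hB
  simp
  field_simp

def CC (u : ℕ → ℝ) (n : ℕ) : ℝ := ∏ k ∈ Finset.range n, (1 - (u (k+1))^2)

lemma CC_pos (u : ℕ → ℝ) (hu : ∀ k, u (k+1) ∈ Ioo (-1 : ℝ) 1) (n : ℕ) : 0 < CC u n := by
  apply Finset.prod_pos
  intro k _
  have := hu k
  nlinarith [this.1, this.2]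

lemma orth (u : ℕ → ℝ) (hu : ∀ k, u (k+1) ∈ Ioo (-1 : ℝ) 1) (N : ℕ) (d : ℕ) : ∀ m, m + d = N →
    (∀ j < m, EE u N (fun z => conj z ^ j * fA u m z) = 0) ∧
    (∀ j, 1 ≤ j → j ≤ m → EE u N (fun z => conj z ^ j * fB u m z) = 0) ∧
    (CC u N : ℂ) * EE u N (fun z => fB u m z) = CC u m := by
  induction d with
  | zero =>
    intro m hm
    obtain rfl : m = N := by omega
    refine ⟨EE_top_A u hu m, fun j h1 _ => ?_, ?_⟩
    · rw [EE_top_B u hu m j, zero_pow (by omega)]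
    · have := EE_top_B u hu m 0
      simp at this
      rw [this, mul_one]
  | succ d ih =>
    intro m hm
    obtain ⟨iA, iB, iC⟩ := ih (m+1) (by omega)
    have hpos : (0:ℝ) < 1 - u (m+1)^2 := by
      have := hu m
      nlinarith [this.1, this.2]
    have hne : ((1 - u (m+1)^2 : ℝ) : ℂ) ≠ 0 := by exact_mod_cast hpos.ne'
    have cA : ∀ j, Continuous (fun z : ℂ => conj z ^ j * fA u (m+1) z) := fun j =>
      (Complex.continuous_conj.pow j).mul (fA_cont u _)
    have cB : ∀ j, Continuous (fun z : ℂ => conj z ^ j * fB u (m+1) z) := fun j =>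
      (Complex.continuous_conj.pow j).mul (fB_cont u _)
    have stepA : ∀ j, ((1 - u (m+1)^2 : ℝ) : ℂ) * EE u N (fun z => conj z ^ j * fA u m z) =
        EE u N (fun z => conj z ^ (j+1) * fA u (m+1) z)
          + u (m+1) * EE u N (fun z => conj z ^ (j+1) * fB u (m+1) z) := by
      intro j
      have c2 : Continuous (fun z : ℂ => (u (m+1) : ℂ) * (conj z ^ (j+1) * fB u (m+1) z)) :=
        continuous_const.mul (cB _)
      rw [← EE_smul, ← EE_smul, ← EE_add u hu N (cA _) c2]
      apply EE_congr
      intro z hz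
      rw [fA_succ, fB_succ]
      push_cast
      linear_combination - (1 - (u (m+1) : ℂ)^2) * conj z ^ j * fA u m z * hz
    have stepB : ∀ j, ((1 - u (m+1)^2 : ℝ) : ℂ) * EE u N (fun z => conj z ^ j * fB u m z) =
        EE u N (fun z => conj z ^ j * fB u (m+1) z)
          + u (m+1) * EE u N (fun z => conj z ^ j * fA u (m+1) z) := by
      intro j
      have c2 : Continuous (fun z : ℂ => (u (m+1) : ℂ) * (conj z ^ j * fA u (m+1) z)) :=
        continuous_const.mul (cA _)
      rw [← EE_smul, ← EE_smul, ← EE_add u hu N (cB _) c2]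
      apply EE_congr
      intro z hz
      rw [fA_succ, fB_succ]
      push_cast
      ring
    refine ⟨fun j hj => ?_, fun j h1 h2 => ?_, ?_⟩
    · have := stepA j
      rw [iA _ (by omega), iB _ (by omega) (by omega)] at this
      rw [mul_zero, add_zero] at this
      exact (mul_eq_zero.1 this).resolve_left hne
    · have := stepB j
      rw [iA _ (by omega), iB _ (by omega) (by omega)] at this
      rw [mul_zero, add_zero] at this
      exact (mul_eq_zero.1 this).resolve_left hne
    · have := stepB 0
      rw [iA _ (by omega)] at this
      simp only [pow_zero, one_mul, mul_zero, add_zero] at this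
      have e : CC u (m+1) = CC u m * (1 - u (m+1)^2) := by
        simp [CC, Finset.prod_range_succ]
      rw [← this, e] at iC
      push_cast at iC hne
      apply mul_left_cancel₀ hne
      linear_combination iC

lemma orth_norm (u : ℕ → ℝ) (hu : ∀ k, u (k+1) ∈ Ioo (-1 : ℝ) 1) (N : ℕ) (m : ℕ) (hm : m ≤ N) :
    (CC u N : ℂ) * EE u N (fun z => fB u m z * conj (fB u m z)) = CC u m := by
  obtain ⟨-, oB, oC⟩ := orth u hu N (N - m) m (by omega)
  have e : EE u N (fun z => fB u m z * conj (fB u m z)) =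
      EE u N (fun z => ∑ j ∈ Finset.range (m+1),
        conj ((szAB u m).2.coeff j) * (conj z ^ j * fB u m z)) := by
    apply EE_congr
    intro z hz
    have : fB u m z = ∑ j ∈ Finset.range (m+1), (szAB u m).2.coeff j * z ^ j :=
      Polynomial.eval_eq_sum_range' (by have := (sz_deg u m).2; omega) z
    have h' : conj (fB u m z) = ∑ j ∈ Finset.range (m+1), conj ((szAB u m).2.coeff j) * conj z ^ j := by
      rw [this, map_sum]; simp
    rw [h', Finset.mul_sum]
    apply Finset.sum_congr rfl
    intro j _
    ring
  have hc : ∀ j, Continuous (fun z : ℂ => conj ((szAB u m).2.coeff j) * (conj z ^ j * fB u m z)) :=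
    fun j => continuous_const.mul ((Complex.continuous_conj.pow j).mul (fB_cont u _))
  rw [e, EE_sum u hu N _ hc, Finset.sum_eq_single 0]
  · rw [EE_smul]
    have : (szAB u m).2.coeff 0 = 1 := by
      rw [Polynomial.coeff_zero_eq_eval_zero]; exact fB_at_zero u m
    rw [this]
    simpa using oC
  · intro j hj hj0
    rw [EE_smul, oB j (by omega) (by simp at hj; omega), mul_zero]
  · simp

lemma exists_V (u : ℕ → ℝ) (n : ℕ) : ∃ V Q U : ℝ[X], ∀ z : ℂ, z * conj z = 1 →
    fB u n z * conj (fB u n z) = (V.eval (2 * z.re) : ℝ) ∧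
    z * fA u n z * conj (fB u n z) =
      (Q.eval (2 * z.re) : ℝ) + Complex.I * z.im * (U.eval (2 * z.re) : ℝ) := by
  induction n with
  | zero =>
    refine ⟨1, C (1/2) * X, 1, fun z hz => ⟨by simp [fB_zero], ?_⟩⟩
    simp [fA_zero, fB_zero]
    apply Complex.ext <;> simp
  | succ n ih =>
    obtain ⟨V, Q, U, h⟩ := ih
    refine ⟨C (1 + u (n+1)^2) * V - C (2 * u (n+1)) * Q,
      C (1/2) * X * (C (1 + u (n+1)^2) * Q - C (2 * u (n+1)) * V)
        - (1 - C (1/4) * X^2) * C (1 - u (n+1)^2) * U,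
      C (1 + u (n+1)^2) * Q - C (2 * u (n+1)) * V + C (1/2) * X * C (1 - u (n+1)^2) * U,
      fun z hz => ?_⟩
    obtain ⟨h1, h2⟩ := h z hz
    have h3 := f_normsq u n z hz
    have h4 : conj z * conj (fA u n z) * fB u n z =
      (Q.eval (2 * z.re) : ℝ) - Complex.I * z.im * (U.eval (2 * z.re) : ℝ) := by
      have := congrArg conj h2
      simp only [map_mul, map_add, Complex.conj_conj, Complex.conj_I, Complex.conj_ofReal] at this
      rw [this]; ring
    rw [fA_succ, fB_succ]
    simp only [eval_add, eval_sub, eval_mul, eval_C, eval_X, eval_pow, eval_one, map_sub, map_mul,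
      Complex.conj_ofReal]
    have hzc : z = z.re + z.im * Complex.I := (Complex.re_add_im z).symm
    have hsq : (z.re : ℂ)^2 + (z.im : ℂ)^2 = 1 := by
      rw [Complex.mul_conj, Complex.normSq_apply] at hz
      rw [← hz]; push_cast; ring
    rw [h1] at h3
    generalize V.eval (2 * z.re) = v at *
    generalize Q.eval (2 * z.re) = q at *
    generalize U.eval (2 * z.re) = w at *
    generalize u (n+1) = t at *
    push_cast
    constructor
    · linear_combination h1 - t * h2 - t * h4 + t^2 * fA u n z * conj (fA u n z) * hz + t^2 * h3
    · have e : (z * fA u n z - t * fB u n z) * (conj (fB u n z) - t * (conj z * conj (fA u n z)))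
          = (1 + t^2) * q - 2 * t * v + Complex.I * z.im * (1 - t^2) * w := by
        linear_combination h2 - t * h1 - t * fA u n z * conj (fA u n z) * hz - t * h3 + t^2 * h4
      rw [mul_assoc, e]
      have hI := Complex.I_sq
      linear_combination ((1 + (t:ℂ)^2) * q - 2 * t * v + Complex.I * z.im * (1 - t^2) * w) * hzc
        + z.im^2 * (1 - (t:ℂ)^2) * w * hI - (1 - (t:ℂ)^2) * w * hsq


lemma arc_half (f : ℝ → ℝ) :
    ∫ x, f x ∂ArcsineM = π⁻¹ * ∫ θ in (0:ℝ)..π, f (2 * Real.cos θ) := by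
  unfold ArcsineM
  rw [integral_withDensity_eq_integral_toReal_smul (by fun_prop)
    (Eventually.of_forall fun x => ENNReal.ofReal_lt_top)]
  have h0 : ∀ x : ℝ, x ∉ Ioo (-2:ℝ) 2 →
      (ENNReal.ofReal (1 / (π * √(4 - x ^ 2)))).toReal • f x = 0 := by
    intro x hx
    have : 4 - x^2 ≤ 0 := by
      by_contra h
      push Not at h
      exact hx ⟨by nlinarith, by nlinarith⟩
    rw [Real.sqrt_eq_zero_of_nonpos this]
    simp
  rw [← setIntegral_eq_integral_of_forall_compl_eq_zero h0]
  have him : (fun θ => 2 * Real.cos θ) '' Ioo 0 π = Ioo (-2:ℝ) 2 := by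
    ext x
    constructor
    · rintro ⟨θ, hθ, rfl⟩
      have h1 := Real.cos_lt_cos_of_nonneg_of_le_pi le_rfl hθ.2.le hθ.1
      have h2 := Real.cos_lt_cos_of_nonneg_of_le_pi hθ.1.le le_rfl hθ.2
      rw [Real.cos_zero] at h1
      rw [Real.cos_pi] at h2
      constructor <;> simp only <;> linarith
    · rintro ⟨h1, h2⟩
      refine ⟨Real.arccos (x/2), ⟨Real.arccos_pos.2 (by linarith), ?_⟩, ?_⟩
      · exact Real.arccos_lt_pi.2 (by linarith)
      · simp only
        rw [Real.cos_arccos (by linarith) (by linarith)]; ring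
  rw [← him, integral_image_eq_integral_abs_deriv_smul (f' := fun θ => 2 * (-Real.sin θ)) measurableSet_Ioo]
  · rw [intervalIntegral.integral_of_le Real.pi_pos.le, ← integral_Ioc_eq_integral_Ioo,
      ← integral_const_mul, integral_Ioc_eq_integral_Ioo, integral_Ioc_eq_integral_Ioo]
    apply setIntegral_congr_fun measurableSet_Ioo
    intro θ hθ
    have hs := Real.sin_pos_of_pos_of_lt_pi hθ.1 hθ.2
    have hq : √(4 - (2 * Real.cos θ)^2) = 2 * Real.sin θ := by
      rw [← Real.sqrt_sq (by positivity : 0 ≤ 2 * Real.sin θ)]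
      congr 1
      nlinarith [Real.sin_sq_add_cos_sq θ]
    have hab : |2 * (-Real.sin θ)| = 2 * Real.sin θ := by
      rw [mul_neg, abs_neg, abs_of_pos (by positivity)]
    simp only [smul_eq_mul]
    rw [hq, hab, ENNReal.toReal_ofReal (by positivity)]
    have := Real.pi_pos
    field_simp
  · intro θ _
    exact ((Real.hasDerivAt_cos θ).const_mul 2).hasDerivWithinAt
  · intro x hx y hy hxy
    exact Real.injOn_cos ⟨hx.1.le, hx.2.le⟩ ⟨hy.1.le, hy.2.le⟩ (by simpa using hxy)

lemma circleMap_re (θ : ℝ) : (circleMap 0 1 θ).re = Real.cos θ := by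
  simp [circleMap, Complex.exp_ofReal_mul_I_re]

lemma arc_circ (f : ℝ → ℝ) (hf : ContinuousOn f (Icc (-2) 2)) :
    ∫ x, f x ∂ArcsineM = Real.circleAverage (fun z : ℂ => f (2 * z.re)) 0 1 := by
  have hc : Continuous (fun θ => f (2 * Real.cos θ)) := by
    apply hf.comp_continuous (by fun_prop)
    intro θ
    constructor <;> linarith [Real.cos_le_one θ, Real.neg_one_le_cos θ]
  rw [arc_half, Real.circleAverage_def]
  simp_rw [circleMap_re]
  have h1 : ∫ θ in π..(2*π), f (2 * Real.cos θ) = ∫ θ in (0:ℝ)..π, f (2 * Real.cos θ) := by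
    have := intervalIntegral.integral_comp_sub_left (a := 0) (b := π)
      (fun θ => f (2 * Real.cos θ)) (2 * π)
    simp only [Real.cos_two_pi_sub] at this
    rw [this]
    congr 1 <;> ring
  rw [← intervalIntegral.integral_add_adjacent_intervals (a := 0) (b := π) (c := 2 * π) (hc.intervalIntegrable _ _)
    (hc.intervalIntegrable _ _), h1, smul_eq_mul]
  have := Real.pi_pos
  field_simp
  ring

lemma arc_ae : ∀ᵐ x ∂ArcsineM, x ∈ Icc (-2:ℝ) 2 := by
  unfold ArcsineM
  rw [ae_withDensity_iff (by fun_prop)]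
  refine Eventually.of_forall fun x hx => ?_
  by_contra h
  apply hx
  have : 4 - x^2 ≤ 0 := by
    by_contra h'
    push Not at h'
    exact h ⟨by nlinarith, by nlinarith⟩
  rw [Real.sqrt_eq_zero_of_nonpos this]
  simp

instance arc_prob : IsProbabilityMeasure ArcsineM := by
  have h := arc_half (fun _ => 1)
  simp [Real.pi_pos.ne'] at h
  constructor
  have h2 : (ArcsineM univ).toReal = 1 := h
  have h3 := (ENNReal.toReal_eq_one_iff _).1 h2
  exact h3

lemma poly_int (μ : Measure ℝ) [IsProbabilityMeasure μ] (hμ : ∀ᵐ x ∂μ, x ∈ Icc (-2:ℝ) 2)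
    (f : ℝ → ℝ) (hm : Measurable f) (hf : ContinuousOn f (Icc (-2) 2)) : Integrable f μ := by
  obtain ⟨C, hC⟩ := isCompact_Icc.exists_bound_of_continuousOn hf
  exact integrable_of_bdd μ hm C (hμ.mono fun x hx => hC x hx)

def VV (u : ℕ → ℝ) (n : ℕ) : ℝ[X] := (exists_V u n).choose

lemma VV_spec (u : ℕ → ℝ) (n : ℕ) (z : ℂ) (hz : z * conj z = 1) :
    fB u n z * conj (fB u n z) = ((VV u n).eval (2 * z.re) : ℝ) := by
  obtain ⟨Q, U, h⟩ := (exists_V u n).choose_spec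
  exact (h z hz).1

lemma VV_pos (u : ℕ → ℝ) (hu : ∀ k, u (k+1) ∈ Ioo (-1 : ℝ) 1) (n : ℕ) (x : ℝ)
    (hx : x ∈ Icc (-2:ℝ) 2) : 0 < (VV u n).eval x := by
  let z : ℂ := circleMap 0 1 (Real.arccos (x/2))
  have hz : z * conj z = 1 := circ_mul (by simp [z])
  have hn : ‖z‖ = 1 := by simp [z]
  have hre : 2 * z.re = x := by
    rw [circleMap_re, Real.cos_arccos (by linarith [hx.1]) (by linarith [hx.2])]; ring
  have h := VV_spec u n z hz
  rw [hre, Complex.mul_conj] at h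
  have h' := Complex.ofReal_injective h
  rw [← h']
  exact Complex.normSq_pos.2 (fB_ne u hu n z hn.le).1

lemma EE_real (u : ℕ → ℝ) (hu : ∀ k, u (k+1) ∈ Ioo (-1 : ℝ) 1) (N : ℕ) (f : ℝ[X]) :
    EE u N (fun z => ((f.eval (2 * z.re) : ℝ) : ℂ)) =
      ((∫ x, f.eval x / (VV u N).eval x ∂ArcsineM : ℝ) : ℂ) := by
  have hcont : ContinuousOn (fun x => f.eval x / (VV u N).eval x) (Icc (-2) 2) :=
    f.continuous.continuousOn.div (VV u N).continuous.continuousOn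
      fun x hx => (VV_pos u hu N x hx).ne'
  rw [arc_circ _ hcont]
  have hci : CircleIntegrable (fun z : ℂ => f.eval (2 * z.re) / (VV u N).eval (2 * z.re)) 0 1 := by
    apply ContinuousOn.circleIntegrable'
    apply hcont.comp (by fun_prop)
    intro z hz
    have hn : ‖z‖ = 1 := by simpa using hz
    have := abs_le.1 ((Complex.abs_re_le_norm z).trans hn.le)
    constructor <;> linarith [this.1, this.2]
  have h2 := Complex.ofRealCLM.circleAverage_comp_comm hci
  simp only [Complex.ofRealCLM_apply] at h2
  rw [← h2]
  unfold EE
  apply Real.circleAverage_congr_sphere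
  intro z hz
  simp only [Function.comp, Complex.ofRealCLM_apply]
  rw [VV_spec u N z (circ_mul hz)]
  push_cast
  rfl

lemma int_log_VV (u : ℕ → ℝ) (hu : ∀ k, u (k+1) ∈ Ioo (-1 : ℝ) 1) (n : ℕ) :
    ∫ x, Real.log ((VV u n).eval x) ∂ArcsineM = 0 := by
  rw [arc_circ]
  · have h := AnalyticOnNhd.circleAverage_log_norm_of_ne_zero (c := 0) (R := 1) (g := fB u n)
      (fun z _ => (fB_diff u n).analyticAt z)
      (fun z hz => (fB_ne u hu n z (by simpa using hz)).1)
    rw [fB_at_zero] at h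
    simp only [norm_one, Real.log_one] at h
    have e : Real.circleAverage (fun z : ℂ => Real.log ((VV u n).eval (2 * z.re))) 0 1 =
        Real.circleAverage (fun z : ℂ => (2:ℝ) • Real.log ‖fB u n z‖) 0 1 := by
      apply Real.circleAverage_congr_sphere
      intro z hz
      have h := VV_spec u n z (circ_mul hz)
      rw [Complex.mul_conj] at h
      have h' := Complex.ofReal_injective h
      simp only
      rw [← h', Complex.normSq_eq_norm_sq, Real.log_pow]
      simp
    rw [e, Real.circleAverage_fun_smul, h]
    simp
  · exact (VV u n).continuous.continuousOn.log fun x hx => (VV_pos u hu n x hx).ne'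

lemma geron (u a b : ℕ → ℝ) (p : ℕ → ℝ[X]) (h0 : u 0 = -1)
    (hu : ∀ k, u (k+1) ∈ Ioo (-1 : ℝ) 1) (hp0 : p 0 = 1)
    (hrec : ∀ (k : ℕ) (x : ℝ), x * (p k).eval x =
      a (k+1) * (p (k+1)).eval x + b (k+1) * (p k).eval x +
        (if k = 0 then 0 else a k * (p (k-1)).eval x))
    (hb : ∀ k : ℕ, b (k+1) = (1 - u (2*k)) * u (2*k+1) - (1 + u (2*k)) * u (2*k-1))
    (ha : ∀ k : ℕ, (a (k+1))^2 = (1 - u (2*k)) * (1 - (u (2*k+1))^2) * (1 + u (2*k+2)))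
    (z : ℂ) (hz : z * conj z = 1) (k : ℕ) :
    (((∏ j ∈ Finset.range k, a (j+1)) * (1 - u (2*k)) * (p k).eval (2 * z.re) : ℝ) : ℂ) =
      conj z ^ k * (fA u (2*k) z + fB u (2*k) z) := by
  have hz0 : z ≠ 0 := by rintro rfl; simp at hz
  have hw : conj z = z⁻¹ := eq_inv_of_mul_eq_one_right hz
  have hx : ((2 * z.re : ℝ) : ℂ) = z + z⁻¹ := by
    rw [← hw, Complex.add_conj]
  rw [hw]
  generalize 2 * z.re = x at hx
  induction k using Nat.twoStepInduction with
  | zero => simp [h0, hp0, fA_zero, fB_zero]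
  | one =>
    have h1 := hrec 0 x
    have hb1 := hb 0
    simp [h0, hp0] at h1 hb1
    simp only [Finset.prod_range_one, mul_one, zero_add]
    have e : a 1 * (1 - u 2) * (p 1).eval x = (1 - u 2) * (x - (1 + 1) * u 1) := by
      rw [hb1] at h1; linear_combination (-(1 - u 2)) * h1
    rw [e]
    rw [fA_succ u 1, fB_succ u 1, fA_succ u 0, fB_succ u 0, fA_zero, fB_zero]
    push_cast
    rw [hx]
    field_simp
    ring
  | more k ih1 ih2 =>
    have h1 := hrec (k+1) x
    have hb1 := hb (k+1)
    have ha1 := ha k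
    simp only [show 2 * (k+1) = 2*k+2 by ring, show 2*(k+1+1) = 2*k+4 by ring,
      show 2*k+2-1 = 2*k+1 by omega, Nat.add_sub_cancel, Nat.succ_ne_zero, if_false,
      Finset.prod_range_succ, reduceIte, add_assoc, Nat.reduceAdd] at *
    have hne : ((1 - u (2*k+2) : ℝ) : ℂ) ≠ 0 := by
      have := (hu (2*k+1)).2
      exact_mod_cast (sub_pos.2 this).ne'
    generalize hD : ∏ j ∈ Finset.range k, a (j+1) = D at *
    have key : (1 - u (2*k+2)) * (D * (a (k+1) * a (k+2)) * (1 - u (2*k+4)) * (p (k+2)).eval x)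
        = (1 - u (2*k+4)) * ((x - b (k+2)) * (D * a (k+1) * (1 - u (2*k+2)) * (p (k+1)).eval x)
          - (1 - u (2*k+1)^2) * (1 - u (2*k+2)^2) * (D * (1 - u (2*k)) * (p k).eval x)) := by
      linear_combination (-(1 - u (2*k+4)) * (1 - u (2*k+2)) * D * a (k+1)) * h1
        - (1 - u (2*k+4)) * (1 - u (2*k+2)) * D * (p k).eval x * ha1
    have key' := congrArg (fun t : ℝ => (t : ℂ)) key
    have hid : (1 - (u (2*k+4) : ℂ)) * ((x - b (k+2)) * (z⁻¹^(k+1) * (fA u (2*k+2) z + fB u (2*k+2) z))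
          - (1 - u (2*k+1)^2) * (1 - u (2*k+2)^2) * (z⁻¹^k * (fA u (2*k) z + fB u (2*k) z)))
        = (1 - u (2*k+2)) * (z⁻¹^(k+2) * (fA u (2*k+4) z + fB u (2*k+4) z)) := by
      rw [hx, hb1, fA_succ u (2*k+3), fB_succ u (2*k+3), fA_succ u (2*k+2), fB_succ u (2*k+2),
        fA_succ u (2*k+1), fB_succ u (2*k+1), fA_succ u (2*k), fB_succ u (2*k)]
      have e2 : z⁻¹^(k+2) = z⁻¹^k * (z⁻¹ * z⁻¹) := by ring
      rw [e2, pow_succ]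
      generalize z⁻¹^k = c
      push_cast
      field_simp
      ring
    apply mul_left_cancel₀ hne
    push_cast at key' ih1 ih2 ⊢
    linear_combination key' + (1 - (u (2*k+4) : ℂ)) * (x - b (k+2)) * ih2
      - (1 - (u (2*k+4) : ℂ)) * (1 - u (2*k+1)^2) * (1 - u (2*k+2)^2) * ih1 + hid


lemma matching (μ : Measure ℝ) [IsProbabilityMeasure μ] (hμ : ∀ᵐ x ∂μ, x ∈ Icc (-2:ℝ) 2)
    (u : ℕ → ℝ) (h : IsCanonicalMoments μ u) (N : ℕ) (f : ℝ[X]) (hf : 2 * f.natDegree ≤ N) :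
    ∫ x, f.eval x ∂μ = CC u N * ∫ x, f.eval x / (VV u N).eval x ∂ArcsineM := by
  obtain ⟨h0, hu, a, b, ⟨hapos, p, hdeg, hlead, horth, hrec⟩, hb, ha⟩ := h
  have hp0 : p 0 = 1 := by
    obtain ⟨c, hc⟩ := natDegree_eq_zero.1 (hdeg 0)
    have h1 := hlead 0
    have h2 := horth 0 0
    rw [← hc] at h1 h2
    simp at h1 h2
    have : c = 1 := by nlinarith
    rw [← hc, this]; simp
  have oA := orth u hu N
  have J1 : CC u N * ∫ x, 1 / (VV u N).eval x ∂ArcsineM = 1 := by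
    have := (oA N 0 (by omega)).2.2
    have e := EE_real u hu N 1
    simp only [fB_zero] at this
    simp only [eval_one, Complex.ofReal_one] at e
    rw [e] at this
    have h2 : CC u 0 = 1 := by simp [CC]
    rw [h2] at this
    exact_mod_cast this
  have Jp : ∀ k, 1 ≤ k → 2 * k ≤ N → ∫ x, (p k).eval x / (VV u N).eval x ∂ArcsineM = 0 := by
    intro k hk1 hk2
    obtain ⟨o1, o2, -⟩ := oA (N - 2 * k) (2 * k) (by omega)
    have e1 := o1 k (by omega)
    have e2 := o2 k hk1 (by omega)
    have c1 : Continuous (fun z : ℂ => conj z ^ k * fA u (2*k) z) :=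
      (Complex.continuous_conj.pow k).mul (fA_cont u _)
    have c2 : Continuous (fun z : ℂ => conj z ^ k * fB u (2*k) z) :=
      (Complex.continuous_conj.pow k).mul (fB_cont u _)
    have e3 := EE_add u hu N c1 c2
    rw [e1, e2, add_zero] at e3
    set D : ℝ := (∏ j ∈ Finset.range k, a (j+1)) * (1 - u (2*k)) with hD
    have hDne : D ≠ 0 := by
      apply mul_ne_zero
      · exact Finset.prod_ne_zero_iff.2 fun j _ => (hapos j).ne'
      · obtain ⟨m, rfl⟩ : ∃ m, k = m + 1 := ⟨k - 1, by omega⟩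
        exact (sub_pos.2 (hu (2*m+1)).2).ne'
    have e4 : EE u N (fun z => (D:ℂ) * (((p k).eval (2 * z.re) : ℝ) : ℂ)) = 0 := by
      rw [← e3]
      apply EE_congr
      intro z hz
      rw [← mul_add, ← geron u a b p h0 hu hp0 hrec hb ha z hz k]
      push_cast [hD]
      ring
    rw [EE_smul, EE_real u hu N] at e4
    have e5 := (mul_eq_zero.1 e4).resolve_left (by exact_mod_cast hDne)
    exact_mod_cast e5
  have intV : ∀ f : ℝ[X], Integrable (fun x => f.eval x / (VV u N).eval x) ArcsineM := fun f =>
    poly_int _ arc_ae _ (f.continuous.measurable.div (VV u N).continuous.measurable)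
      (f.continuous.continuousOn.div (VV u N).continuous.continuousOn
        fun x hx => (VV_pos u hu N x hx).ne')
  have intμ : ∀ f : ℝ[X], Integrable (fun x => f.eval x) μ := fun f =>
    poly_int _ hμ _ f.continuous.measurable f.continuous.continuousOn
  have main : ∀ m, 2 * m ≤ N → ∀ f : ℝ[X], f.natDegree ≤ m →
      ∫ x, f.eval x ∂μ = CC u N * ∫ x, f.eval x / (VV u N).eval x ∂ArcsineM := by
    intro m
    induction m with
    | zero =>
      intro _ f hf
      obtain ⟨c, rfl⟩ := natDegree_eq_zero.1 (Nat.le_zero.1 hf)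
      simp only [eval_C]
      have : ∀ x, c / (VV u N).eval x = c * (1 / (VV u N).eval x) := fun x => by ring
      simp_rw [this]
      rw [integral_const_mul]
      simp only [integral_const, probReal_univ, one_smul]
      linear_combination (-c) * J1
    | succ m ih =>
      intro hm f hf
      set c := f.coeff (m+1) / (p (m+1)).leadingCoeff with hc
      set g := f - C c * p (m+1) with hg
      have hgd : g.natDegree ≤ m := by
        rw [natDegree_le_iff_coeff_eq_zero]
        intro i hi
        rcases (Nat.succ_le_of_lt hi).eq_or_lt with h | h
        · rw [← h, hg]
          have h1 : (p (m+1)).coeff (m+1) = (p (m+1)).leadingCoeff := by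
            rw [leadingCoeff, hdeg]
          simp only [coeff_sub, coeff_C_mul, Nat.succ_eq_add_one, h1, hc]
          field_simp [(hlead (m+1)).ne']
          ring
        · rw [hg, coeff_sub, coeff_C_mul, coeff_eq_zero_of_natDegree_lt (by omega),
            coeff_eq_zero_of_natDegree_lt (by rw [hdeg]; omega)]
          ring
      have ef : ∀ x, f.eval x = g.eval x + c * (p (m+1)).eval x := by
        intro x; simp [hg]
      have ef2 : ∀ x, f.eval x / (VV u N).eval x =
          g.eval x / (VV u N).eval x + c * ((p (m+1)).eval x / (VV u N).eval x) := by
        intro x; rw [ef]; ring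
      have i0 : ∫ x, (p (m+1)).eval x ∂μ = 0 := by
        have := horth 0 (m+1)
        simpa [hp0] using this
      simp_rw [ef2]
      simp_rw [ef]
      rw [integral_add (intμ g) ((intμ _).const_mul c), integral_add (intV g) ((intV _).const_mul c),
        integral_const_mul, integral_const_mul, Jp (m+1) (by omega) hm, i0, ih (by omega) g hgd]
      ring
  exact main f.natDegree hf f le_rfl

lemma int_VV (μ : Measure ℝ) [IsProbabilityMeasure μ] (hμ : ∀ᵐ x ∂μ, x ∈ Icc (-2:ℝ) 2)
    (u : ℕ → ℝ) (h : IsCanonicalMoments μ u) (n : ℕ) :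
    ∫ x, (VV u n).eval x ∂μ = CC u n := by
  have hu := h.2.1
  set N := max n (2 * (VV u n).natDegree)
  rw [matching μ hμ u h N (VV u n) (le_max_right _ _)]
  have h1 := orth_norm u hu N n (le_max_left _ _)
  have h2 : EE u N (fun z => fB u n z * conj (fB u n z)) =
      EE u N (fun z => (((VV u n).eval (2 * z.re) : ℝ) : ℂ)) :=
    EE_congr u N fun z hz => VV_spec u n z hz
  rw [h2, EE_real u hu N] at h1
  exact_mod_cast h1

lemma log_CC (u : ℕ → ℝ) (hu : ∀ k, u (k+1) ∈ Ioo (-1 : ℝ) 1) (n : ℕ) :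
    ∑ k ∈ Finset.range n, -Real.log (1 - u (k+1)^2) = - Real.log (CC u n) := by
  unfold CC
  rw [Real.log_prod, Finset.sum_neg_distrib]
  intro k _
  have := hu k
  nlinarith [this.1, this.2]

lemma log_nn (u : ℕ → ℝ) (hu : ∀ k, u (k+1) ∈ Ioo (-1 : ℝ) 1) (k : ℕ) :
    0 ≤ -Real.log (1 - u (k+1)^2) := by
  have := hu k
  have h := Real.log_nonpos (x := 1 - u (k+1)^2) (by nlinarith [this.1, this.2])
    (by nlinarith [sq_nonneg (u (k+1))])
  linarith

lemma int_log_W (u : ℕ → ℝ) (hu : ∀ k, u (k+1) ∈ Ioo (-1 : ℝ) 1) (n : ℕ) :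
    Integrable (fun x => Real.log ((VV u n).eval x) - Real.log (CC u n)) ArcsineM ∧
    ∫ x, (Real.log ((VV u n).eval x) - Real.log (CC u n)) ∂ArcsineM = - Real.log (CC u n) := by
  have hi : Integrable (fun x => Real.log ((VV u n).eval x)) ArcsineM :=
    poly_int _ arc_ae _ (Real.measurable_log.comp (VV u n).continuous.measurable)
      ((VV u n).continuous.continuousOn.log fun x hx => (VV_pos u hu n x hx).ne')
  refine ⟨hi.sub (integrable_const _), ?_⟩
  rw [integral_sub hi (integrable_const _), int_log_VV u hu n]
  simp

lemma lower (μ : Measure ℝ) [IsProbabilityMeasure μ] (hμ : ∀ᵐ x ∂μ, x ∈ Icc (-2:ℝ) 2)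
    (u : ℕ → ℝ) (h : IsCanonicalMoments μ u) (n : ℕ) :
    ENNReal.ofReal (- Real.log (CC u n)) ≤ KLdiv ArcsineM μ := by
  have hu := h.2.1
  have hC := CC_pos u hu n
  obtain ⟨h1, h2⟩ := int_log_W u hu n
  have hae : (fun x => Real.exp (Real.log ((VV u n).eval x) - Real.log (CC u n))) =ᵐ[μ]
      fun x => (VV u n).eval x / CC u n := by
    filter_upwards [hμ] with x hx
    rw [Real.exp_sub, Real.exp_log (VV_pos u hu n x hx), Real.exp_log hC]
  have hV : Integrable (fun x => (VV u n).eval x) μ :=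
    poly_int _ hμ _ (VV u n).continuous.measurable (VV u n).continuous.continuousOn
  have h3 := dv_lower ArcsineM μ _ h1 ((hV.div_const _).congr hae.symm)
  rw [h2, integral_congr_ae hae, integral_div, int_VV μ hμ u h n, div_self hC.ne', Real.log_one,
    sub_zero] at h3
  exact h3

lemma upper_p (μ : Measure ℝ) [IsProbabilityMeasure μ] (hμ : ∀ᵐ x ∂μ, x ∈ Icc (-2:ℝ) 2)
    (u : ℕ → ℝ) (h : IsCanonicalMoments μ u) (p : ℝ[X])
    (hp : ∀ x ∈ Icc (-2:ℝ) 2, 0 < p.eval x) :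
    ∫ x, Real.log (p.eval x) ∂ArcsineM ≤
      - Real.log (CC u (2 * p.natDegree)) + ∫ x, p.eval x ∂μ - 1 := by
  have hu := h.2.1
  set N := 2 * p.natDegree
  have hC := CC_pos u hu N
  obtain ⟨h1, h2⟩ := int_log_W u hu N
  have hpl : Integrable (fun x => Real.log (p.eval x)) ArcsineM :=
    poly_int _ arc_ae _ (Real.measurable_log.comp p.continuous.measurable)
      (p.continuous.continuousOn.log fun x hx => (hp x hx).ne')
  have intV : Integrable (fun x => p.eval x / (VV u N).eval x) ArcsineM :=
    poly_int _ arc_ae _ (p.continuous.measurable.div (VV u N).continuous.measurable)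
      (p.continuous.continuousOn.div (VV u N).continuous.continuousOn
        fun x hx => (VV_pos u hu N x hx).ne')
  have h3 : ∫ x, (Real.log (p.eval x) - (Real.log ((VV u N).eval x) - Real.log (CC u N))) ∂ArcsineM
      ≤ ∫ x, (CC u N * (p.eval x / (VV u N).eval x) - 1) ∂ArcsineM := by
    apply integral_mono_ae (hpl.sub h1) ((intV.const_mul _).sub (integrable_const _))
    filter_upwards [arc_ae] with x hx
    have hv := VV_pos u hu N x hx
    have hpx := hp x hx
    have := Real.log_le_sub_one_of_pos (x := CC u N * (p.eval x / (VV u N).eval x)) (by positivity)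
    simp only [Pi.sub_apply]
    rw [Real.log_mul hC.ne' (by positivity), Real.log_div hpx.ne' hv.ne'] at this
    linarith
  rw [integral_sub hpl h1, h2, integral_sub (intV.const_mul _) (integrable_const _),
    integral_const_mul, ← matching μ hμ u h N p le_rfl] at h3
  simp at h3
  linarith

/-- **Arcsine sum rule.** -/
theorem arcsine_sum_rule (μ : Measure ℝ) [IsProbabilityMeasure μ]
    (hsupp : μ (Icc (-2) 2)ᶜ = 0) (hnt : InfiniteSupport μ)
    (u : ℕ → ℝ) (hu : IsCanonicalMoments μ u) :
    KLdiv ArcsineM μ = ∑' k : ℕ, ENNReal.ofReal (-Real.log (1 - (u (k+1))^2)) := by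
  have hμ : ∀ᵐ x ∂μ, x ∈ Icc (-2:ℝ) 2 := hsupp
  have hu' := hu.2.1
  have hs : ∀ n, ∑ k ∈ Finset.range n, ENNReal.ofReal (-Real.log (1 - (u (k+1))^2)) =
      ENNReal.ofReal (- Real.log (CC u n)) := by
    intro n
    rw [← log_CC u hu' n, ENNReal.ofReal_sum_of_nonneg fun k _ => log_nn u hu' k]
  apply le_antisymm
  · by_cases ht : ∑' k : ℕ, ENNReal.ofReal (-Real.log (1 - (u (k+1))^2)) = ⊤
    · rw [ht]; exact le_top
    · rw [← ENNReal.ofReal_toReal ht]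
      apply kl_upper ArcsineM μ arc_ae hμ
      intro p hp
      have h1 := upper_p μ hμ u hu p hp
      have h2 : - Real.log (CC u (2 * p.natDegree)) ≤
          (∑' k : ℕ, ENNReal.ofReal (-Real.log (1 - (u (k+1))^2))).toReal := by
        rw [← ENNReal.ofReal_le_iff_le_toReal ht, ← hs]
        exact ENNReal.sum_le_tsum _
      linarith
  · rw [ENNReal.tsum_eq_iSup_nat]
    apply iSup_le
    intro n
    rw [hs]
    exact lower μ hμ u hu n


end SumRules
end
end

section
/- Let (u_k)_{k≥1} be a real sequence with u_k ∈ (−1,1) for all k ≥ 1, set u₀ = −1, and define a_{k+1} > 0 by a_{k+1}² = (1−u_{2k})(1−u_{2k+1}²)(1+u_{2k+2}) for k ≥ 0. Then the series ∑_{k=1}^∞ −log(1−u_k²) (with nonnegative terms) converges if and only if the series ∑_{k=1}^∞ log a_k² converges; when they converge, lim_{n→∞} u_{2n} = 0 and log 2 − ∑_{k=1}^∞ log a_k² = −∑_{k=1}^∞ log(1−u_k²); and when ∑_{k=1}^∞ −log(1−u_k²) = +∞, the partial sums ∑_{k=1}^n log a_k² tend to −∞. -/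
open MeasureTheory Real Filter Set Topology Polynomial
open scoped ENNReal ComplexConjugate

noncomputable section

namespace SumRules

/-- Equivalence of the canonical-moment and the Simon–Zlatoš coefficient sides of the
`C₀` (Arcsine) sum rule. -/
theorem canonical_moment_series_equivalence (u a : ℕ → ℝ) (hu0 : u 0 = -1)
    (hu : ∀ k : ℕ, u (k+1) ∈ Ioo (-1 : ℝ) 1) (ha : ∀ k : ℕ, 0 < a (k+1))
    (hau : ∀ k : ℕ,
      (a (k+1))^2 = (1 - u (2*k)) * (1 - (u (2*k+1))^2) * (1 + u (2*k+2))) :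
    (Summable (fun k : ℕ => -Real.log (1 - (u (k+1))^2)) ↔
      ∃ L : ℝ, Tendsto (fun n : ℕ => ∑ k ∈ Finset.range n, Real.log ((a (k+1))^2))
        atTop (𝓝 L)) ∧
    (Summable (fun k : ℕ => -Real.log (1 - (u (k+1))^2)) →
      Tendsto (fun n : ℕ => u (2*n)) atTop (𝓝 0) ∧
      Tendsto (fun n : ℕ => Real.log 2 - ∑ k ∈ Finset.range n, Real.log ((a (k+1))^2))
        atTop (𝓝 (∑' k : ℕ, -Real.log (1 - (u (k+1))^2)))) ∧
    (¬ Summable (fun k : ℕ => -Real.log (1 - (u (k+1))^2)) →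
      Tendsto (fun n : ℕ => ∑ k ∈ Finset.range n, Real.log ((a (k+1))^2)) atTop atBot) := by
  have hlt : ∀ k : ℕ, 0 < 1 - (u (k+1))^2 := fun k => by
    have := hu k
    nlinarith [this.1, this.2]
  have hnn : ∀ k : ℕ, 0 ≤ -Real.log (1 - (u (k+1))^2) := fun k => by
    have := Real.log_nonpos (hlt k).le (by nlinarith [sq_nonneg (u (k+1))])
    linarith
  have hm : ∀ k : ℕ, 0 < 1 - u (2*k) := fun k => by
    rcases k with _ | k
    · simp [hu0]
    · have := (hu (2*k+1)).2
      have e : 2*(k+1) = 2*k+1+1 := by ring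
      rw [e]; linarith
  set f : ℕ → ℝ := fun k => -Real.log (1 - (u (k+1))^2) with hf
  have key : ∀ n : ℕ, ∑ k ∈ Finset.range n, Real.log ((a (k+1))^2)
      = Real.log 2 - ∑ k ∈ Finset.range (2*n), f k - Real.log (1 - u (2*n)) := by
    intro n
    induction n with
    | zero => simp [hu0]; norm_num
    | succ n ih =>
      have h1 := hm n
      have h2 := hlt (2*n)
      have h3 : 0 < 1 + u (2*n+2) := by have := (hu (2*n+1)).1; linarith
      have h4 : 0 < 1 - u (2*n+2) := by have := (hu (2*n+1)).2; linarith
      have e : 2*(n+1) = 2*n+1+1 := by ring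
      rw [Finset.sum_range_succ, ih, hau n, Real.log_mul (by positivity) h3.ne',
        Real.log_mul h1.ne' h2.ne', e, Finset.sum_range_succ, Finset.sum_range_succ]
      have h5 : Real.log (1 - (u (2*n+1+1))^2)
          = Real.log (1 - u (2*n+2)) + Real.log (1 + u (2*n+2)) := by
        rw [← Real.log_mul h4.ne' h3.ne']; congr 1; ring
      simp only [hf, h5]
      ring
  have two : Tendsto (fun n : ℕ => 2*n) atTop atTop :=
    tendsto_id.const_mul_atTop' (by norm_num)
  have B : Summable f →
      Tendsto (fun n : ℕ => u (2*n)) atTop (𝓝 0) ∧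
      Tendsto (fun n : ℕ => Real.log 2 - ∑ k ∈ Finset.range n, Real.log ((a (k+1))^2))
        atTop (𝓝 (∑' k : ℕ, f k)) := by
    intro hs
    have h0 := hs.tendsto_atTop_zero
    have hsq : Tendsto (fun k : ℕ => (u (k+1))^2) atTop (𝓝 0) := by
      refine squeeze_zero (fun k => sq_nonneg _) (fun k => ?_) h0
      have := Real.log_le_sub_one_of_pos (hlt k)
      simp only [hf]; linarith
    have hu1 : Tendsto (fun k : ℕ => u (k+1)) atTop (𝓝 0) := by
      have := hsq.sqrt
      simp only [Real.sqrt_sq_eq_abs, Real.sqrt_zero] at this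
      exact (tendsto_zero_iff_abs_tendsto_zero _).2 this
    have hu2 : Tendsto (fun n : ℕ => u (2*n)) atTop (𝓝 0) :=
      ((tendsto_add_atTop_iff_nat 1).1 hu1).comp two
    refine ⟨hu2, ?_⟩
    have hl : Tendsto (fun n : ℕ => Real.log (1 - u (2*n))) atTop (𝓝 0) := by
      have := (tendsto_const_nhds (x := (1:ℝ))).sub hu2
      rw [sub_zero] at this
      have := this.log one_ne_zero
      rwa [Real.log_one] at this
    have := (hs.hasSum.tendsto_sum_nat.comp two).add hl
    rw [add_zero] at this
    refine this.congr fun n => ?_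
    rw [key n]; simp only [Function.comp]; ring
  have C : ¬ Summable f →
      Tendsto (fun n : ℕ => ∑ k ∈ Finset.range n, Real.log ((a (k+1))^2)) atTop atBot := by
    intro hs
    have ht := (not_summable_iff_tendsto_nat_atTop_of_nonneg hnn).1 hs
    rw [← tendsto_add_atTop_iff_nat 1]
    have t' : Tendsto (fun n : ℕ => 2*n+1) atTop atTop := tendsto_atTop_mono (fun n => Nat.le_succ _) two
    have h6 : Tendsto (fun n : ℕ => 2 * Real.log 2 - ∑ k ∈ Finset.range (2*n+1), f k)
        atTop atBot := by
      simp only [sub_eq_add_neg]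
      exact tendsto_atBot_add_const_left _ _ (tendsto_neg_atTop_atBot.comp (ht.comp t'))
    refine tendsto_atBot_mono (fun n => ?_) h6
    have h3 : 0 < 1 + u (2*n+2) := by have := (hu (2*n+1)).1; linarith
    have h4 : 0 < 1 - u (2*n+2) := by have := (hu (2*n+1)).2; linarith
    have h5 : Real.log (1 - (u (2*n+1+1))^2)
        = Real.log (1 - u (2*n+2)) + Real.log (1 + u (2*n+2)) := by
      rw [← Real.log_mul h4.ne' h3.ne']; congr 1; ring
    have h7 : Real.log (1 + u (2*n+2)) ≤ Real.log 2 := Real.log_le_log h3 (by linarith)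
    have e : 2*(n+1) = 2*n+1+1 := by ring
    have h8 : f (2*n+1) = -(Real.log (1 - u (2*n+2)) + Real.log (1 + u (2*n+2))) := by
      simp only [hf, h5]
    rw [key (n+1), e, Finset.sum_range_succ, h8]
    linarith
  refine ⟨⟨fun hs => ⟨Real.log 2 - ∑' k, f k, ?_⟩, ?_⟩, B, C⟩
  · have := (tendsto_const_nhds (x := Real.log 2)).sub (B hs).2
    simpa using this
  · rintro ⟨L, hL⟩
    by_contra hs
    exact not_tendsto_nhds_of_tendsto_atBot (C hs) L hL

end SumRules
end
end

section
/- Szegő–Verblunsky sum rule: For every nontrivial probability measure ν on the unit circle 𝕋 with Verblunsky coefficients (α_k)_{k≥0}, one has K(UNIF | ν) = −∑_{k=0}^∞ log(1−|α_k|²), where UNIF is the normalized Lebesgue measure dθ/2π on 𝕋, and where both sides may be infinite simultaneously. -/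
open MeasureTheory Real Filter Set Topology Polynomial
open scoped ENNReal ComplexConjugate

noncomputable section

namespace SumRules

lemma sv_deg (c : ℂ) (P : Polynomial ℂ) : (C c * P).degree ≤ P.degree := by
  rw [← smul_eq_C_mul]; exact degree_smul_le _ _

lemma sv_norm_ctheta (θ : ℝ) : ‖ctheta θ‖ = 1 := Complex.norm_exp_ofReal_mul_I θ

lemma sv_cont_ctheta : Continuous ctheta := by unfold ctheta; fun_prop

lemma sv_cont_poly (P : Polynomial ℂ) : Continuous fun θ => P.eval (ctheta θ) :=
  P.continuous.comp sv_cont_ctheta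

lemma sv_bdd {E : Type*} [NormedAddCommGroup E] (f : ℂ → E) (hf : Continuous f) :
    ∃ M : ℝ, ∀ θ : ℝ, ‖f (ctheta θ)‖ ≤ M := by
  obtain ⟨M, hM⟩ := (isCompact_sphere (0:ℂ) 1).exists_bound_of_continuousOn hf.continuousOn
  exact ⟨M, fun θ => hM _ (by simp [sv_norm_ctheta])⟩

lemma sv_int {E : Type*} [NormedAddCommGroup E] [SecondCountableTopology E]
    (ν : Measure ℝ) [IsProbabilityMeasure ν] (f : ℂ → E)
    (hf : Continuous f) : Integrable (fun θ => f (ctheta θ)) ν := by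
  obtain ⟨M, hM⟩ := sv_bdd f hf
  exact Integrable.of_bound (hf.comp sv_cont_ctheta).aestronglyMeasurable M
    (Eventually.of_forall hM)

lemma sv_norm_reflect (N : ℕ) (P : Polynomial ℂ) (hP : P.natDegree ≤ N) (z : ℂ) (hz : ‖z‖ = 1) :
    ‖(reflect N (P.map (starRingEnd ℂ))).eval z‖ = ‖P.eval z‖ := by
  have hz0 : z ≠ 0 := by rintro rfl; simp at hz
  have hc : conj z = z⁻¹ := by
    rw [Complex.inv_def, Complex.normSq_eq_norm_sq, hz]; simp
  let _ : Invertible (z⁻¹) := invertibleOfNonzero (inv_ne_zero hz0)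
  have h := eval₂_reflect_mul_pow (RingHom.id ℂ) (z⁻¹) N (P.map (starRingEnd ℂ))
    (by rw [natDegree_map]; exact hP)
  have e1 : ⅟(z⁻¹) = z := by simp [invOf_eq_inv]
  rw [e1, ← hc] at h
  simp only [eval₂_id] at h
  rw [eval_map, eval₂_hom] at h
  have := congrArg norm h
  simpa [hz] using this

/-- squared norm -/
def svN (ν : Measure ℝ) (P : Polynomial ℂ) : ℝ := ∫ θ, ‖P.eval (ctheta θ)‖^2 ∂ν

lemma svN_congr (ν : Measure ℝ) {P Q : Polynomial ℂ}
    (h : ∀ z : ℂ, ‖z‖ = 1 → ‖P.eval z‖ = ‖Q.eval z‖) : svN ν P = svN ν Q := by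
  unfold svN
  simp_rw [fun θ => h _ (sv_norm_ctheta θ)]

lemma svN_nonneg (ν : Measure ℝ) (P : Polynomial ℂ) : 0 ≤ svN ν P :=
  integral_nonneg fun _ => by positivity

lemma svN_C_mul (ν : Measure ℝ) (c : ℂ) (P : Polynomial ℂ) :
    svN ν (C c * P) = ‖c‖^2 * svN ν P := by
  unfold svN
  simp [mul_pow, integral_const_mul]

lemma sv_pyth (ν : Measure ℝ) [IsProbabilityMeasure ν] (P Q : Polynomial ℂ)
    (h : ∫ θ, conj (P.eval (ctheta θ)) * Q.eval (ctheta θ) ∂ν = 0) :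
    svN ν (P + Q) = svN ν P + svN ν Q := by
  unfold svN
  have hPc := P.continuous
  have hQc := Q.continuous
  have i1 : Integrable (fun θ => ‖P.eval (ctheta θ)‖^2) ν :=
    sv_int ν (fun z => ‖P.eval z‖^2) (by fun_prop)
  have i2 : Integrable (fun θ => ‖Q.eval (ctheta θ)‖^2) ν :=
    sv_int ν (fun z => ‖Q.eval z‖^2) (by fun_prop)
  have i3 : Integrable (fun θ => conj (P.eval (ctheta θ)) * Q.eval (ctheta θ)) ν :=
    sv_int ν (fun z => conj (P.eval z) * Q.eval z)
      ((Complex.continuous_conj.comp hPc).mul hQc)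
  have i4 : ∫ θ, (conj (P.eval (ctheta θ)) * Q.eval (ctheta θ)).re ∂ν = 0 := by
    have := integral_re i3
    simp only [RCLike.re_to_complex] at this
    rw [this, h]; simp
  have i3' : Integrable (fun θ => (conj (P.eval (ctheta θ)) * Q.eval (ctheta θ)).re) ν := i3.re
  have e : ∀ θ, ‖(P+Q).eval (ctheta θ)‖^2 = ‖P.eval (ctheta θ)‖^2 + ‖Q.eval (ctheta θ)‖^2
      + 2 * (conj (P.eval (ctheta θ)) * Q.eval (ctheta θ)).re := by
    intro θ
    simp only [← Complex.normSq_eq_norm_sq, eval_add, Complex.normSq_add]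
    congr 2
    simp [Complex.mul_re]
  simp_rw [e]
  rw [integral_add (by exact i1.add i2) (i3'.const_mul 2), integral_add i1 i2, integral_const_mul, i4]
  simp

lemma sv_orth (ν : Measure ℝ) [IsProbabilityMeasure ν] (Φ : ℕ → Polynomial ℂ)
    (hm : ∀ k, (Φ k).Monic) (hd : ∀ k, (Φ k).natDegree = k)
    (ho : ∀ j k, j ≠ k →
      ∫ θ, conj ((Φ j).eval (ctheta θ)) * (Φ k).eval (ctheta θ) ∂ν = 0) (n : ℕ) :
    ∀ m ≤ n, ∀ R : Polynomial ℂ, R.degree < m →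
      ∫ θ, conj ((Φ n).eval (ctheta θ)) * R.eval (ctheta θ) ∂ν = 0 := by
  intro m
  induction m with
  | zero =>
    intro _ R hR
    have : R = 0 := by
      rw [← degree_eq_bot]; simpa using hR
    simp [this]
  | succ m ih =>
    intro hmn R hR
    set c := R.coeff m with hc
    have hdeg : (R - C c * Φ m).degree < m := by
      rw [degree_lt_iff_coeff_zero] at hR ⊢
      intro k hk
      rcases hk.eq_or_lt with rfl | hk
      · have := (hm m).coeff_natDegree
        rw [hd] at this
        simp [this, hc]
      · have h1 := hR k hk
        have h2 : (Φ m).coeff k = 0 := coeff_eq_zero_of_natDegree_lt (by rw [hd]; exact hk)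
        simp [h1, h2]
    have h1 := ih (by omega) _ hdeg
    have h2 := ho n m (by omega)
    have e : ∀ θ, conj ((Φ n).eval (ctheta θ)) * R.eval (ctheta θ) =
      conj ((Φ n).eval (ctheta θ)) * (R - C c * Φ m).eval (ctheta θ) +
      c * (conj ((Φ n).eval (ctheta θ)) * (Φ m).eval (ctheta θ)) := by
      intro θ; simp; ring
    have hPc := (Φ n).continuous
    have hcc := Complex.continuous_conj.comp hPc
    simp_rw [e]
    rw [integral_add, h1, integral_const_mul, h2]
    · simp
    · exact sv_int ν (fun z => conj ((Φ n).eval z) * (R - C c * Φ m).eval z)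
        (hcc.mul (R - C c * Φ m).continuous)
    · exact sv_int ν (fun z => c * (conj ((Φ n).eval z) * (Φ m).eval z))
        (continuous_const.mul (hcc.mul (Φ m).continuous))

lemma sv_pyth2 (ν : Measure ℝ) [IsProbabilityMeasure ν] (Φ : Polynomial ℂ) (n : ℕ)
    (ho : ∀ R : Polynomial ℂ, R.degree < n →
      ∫ θ, conj (Φ.eval (ctheta θ)) * R.eval (ctheta θ) ∂ν = 0) (c : ℂ) (R : Polynomial ℂ)
    (hR : R.degree < n) : svN ν (C c * Φ + R) = ‖c‖^2 * svN ν Φ + svN ν R := by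
  rw [sv_pyth, svN_C_mul]
  have e : ∀ θ, conj ((C c * Φ).eval (ctheta θ)) * R.eval (ctheta θ) =
    conj c * (conj (Φ.eval (ctheta θ)) * R.eval (ctheta θ)) := by intro θ; simp; ring
  simp_rw [e]
  rw [integral_const_mul, ho R hR, mul_zero]

/-- OPUC facts. -/
lemma sv_opuc (ν : Measure ℝ) [IsProbabilityMeasure ν] (α : ℕ → ℂ) (hα : IsVerblunsky ν α)
    (n : ℕ) : ∃ Φ : Polynomial ℂ, Φ.Monic ∧
      svN ν Φ = ∏ k ∈ Finset.range n, (1 - ‖α k‖^2) ∧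
      (∀ z, ‖z‖ = 1 → Φ.eval z ≠ 0) ∧
      ∀ P : Polynomial ℂ, P.natDegree ≤ n → ‖P.eval 0‖^2 * svN ν Φ ≤ svN ν P := by
  obtain ⟨hlt, Φ, hm, hd, ho, hrec⟩ := hα
  have hor : ∀ n : ℕ, ∀ R : Polynomial ℂ, R.degree < n →
      ∫ θ, conj ((Φ n).eval (ctheta θ)) * R.eval (ctheta θ) ∂ν = 0 :=
    fun n => sv_orth ν Φ hm hd ho n n le_rfl
  have hnorm : svN ν (Φ n) = ∏ k ∈ Finset.range n, (1 - ‖α k‖^2) := by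
    induction n with
    | zero =>
      have : Φ 0 = 1 := (hm 0).natDegree_eq_zero.mp (hd 0)
      simp [this, svN]
    | succ n ih =>
      rw [Finset.prod_range_succ, ← ih]
      have h1 : svN ν (X * Φ n) = svN ν (Φ n) := svN_congr ν fun z hz => by simp [hz]
      have hs : (polyStar (Φ n)).degree < ((n+1 : ℕ) : WithBot ℕ) := by
        refine lt_of_le_of_lt degree_le_natDegree ?_
        have : (polyStar (Φ n)).natDegree ≤ n := by
          unfold polyStar
          refine (reverse_natDegree_le _).trans ?_
          rw [natDegree_map, hd]
        exact_mod_cast Nat.lt_succ_of_le this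
      have h2 := sv_pyth2 ν (Φ (n+1)) (n+1) (hor (n+1)) 1 (C (conj (α n)) * polyStar (Φ n))
        ((sv_deg _ _).trans_lt hs)
      have h3 : svN ν (polyStar (Φ n)) = svN ν (Φ n) := svN_congr ν fun z hz => by
        unfold polyStar reverse
        exact sv_norm_reflect _ _ (by rw [natDegree_map]) z hz
      have h4 : C 1 * Φ (n+1) + C (conj (α n)) * polyStar (Φ n) = X * Φ n := by
        rw [hrec]; simp
      rw [h4, h1, svN_C_mul, h3] at h2
      simp at h2
      linarith
  have hpos : 0 < svN ν (Φ n) := by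
    rw [hnorm]
    refine Finset.prod_pos fun k _ => ?_
    have := hlt k
    have := norm_nonneg (α k)
    nlinarith
  refine ⟨Φ n, hm n, hnorm, ?_, ?_⟩
  · intro z hz h0
    obtain ⟨q, hq⟩ := dvd_iff_isRoot.mpr (show (Φ n).IsRoot z from h0)
    have hq0 : q ≠ 0 := by rintro rfl; exact (hm n).ne_zero (by simpa using hq)
    have hqd : q.degree < n := by
      have := congrArg natDegree hq
      rw [natDegree_mul (X_sub_C_ne_zero z) hq0, natDegree_X_sub_C, hd] at this
      rw [degree_eq_natDegree hq0]
      exact_mod_cast (by omega : q.natDegree < n)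
    have h2 := sv_pyth2 ν (Φ n) n (hor n) 1 (C z * q) ((sv_deg _ _).trans_lt hqd)
    have h4 : C 1 * Φ n + C z * q = X * q := by rw [hq]; simp; ring
    have h1 : svN ν (X * q) = svN ν q := svN_congr ν fun z hz => by simp [hz]
    rw [h4, h1, svN_C_mul, hz] at h2
    simp at h2
    exact hpos.ne' h2
  · intro P hP
    set Q := reflect n (P.map (starRingEnd ℂ)) with hQ
    have h1 : svN ν Q = svN ν P := svN_congr ν fun z hz => sv_norm_reflect n P hP z hz
    set c := conj (P.eval 0) with hc
    have hQn : Q.coeff n = c := by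
      rw [hQ, coeff_reflect]
      simp [hc, coeff_zero_eq_eval_zero]
    have hdeg : (Q - C c * Φ n).degree < n := by
      rw [degree_lt_iff_coeff_zero]
      intro k hk
      rcases hk.eq_or_lt with rfl | hk
      · have := (hm n).coeff_natDegree
        rw [hd] at this
        simp [this, hQn]
      · have h2 : (Φ n).coeff k = 0 := coeff_eq_zero_of_natDegree_lt (by rw [hd]; exact hk)
        have h3 : Q.coeff k = 0 := by
          rw [hQ, coeff_reflect, revAt_eq_self_of_lt hk, coeff_map,
            coeff_eq_zero_of_natDegree_lt (by omega), map_zero]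
        simp [h2, h3]
    have h2 := sv_pyth2 ν (Φ n) n (hor n) c _ hdeg
    have h3 : ‖c‖ = ‖P.eval 0‖ := by simp [hc]
    rw [add_sub_cancel, h1, h3] at h2
    have := svN_nonneg ν (Q - C c * Φ n)
    linarith

lemma sv_int' {E : Type*} [NormedAddCommGroup E] [SecondCountableTopology E]
    (ν : Measure ℝ) [IsProbabilityMeasure ν] (f : ℂ → E)
    (hf : ContinuousOn f (Metric.sphere 0 1)) : Integrable (fun θ => f (ctheta θ)) ν := by
  obtain ⟨M, hM⟩ := (isCompact_sphere (0:ℂ) 1).exists_bound_of_continuousOn hf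
  have hc : Continuous (fun θ => f (ctheta θ)) :=
    hf.comp_continuous sv_cont_ctheta (fun θ => by simp [sv_norm_ctheta])
  exact Integrable.of_bound hc.aestronglyMeasurable M
    (Eventually.of_forall fun θ => hM _ (by simp [sv_norm_ctheta]))

lemma sv_unif_eq : UNIFm = ENNReal.ofReal (1/(2*π)) • volume.restrict (Ico 0 (2*π)) := by
  unfold UNIFm
  rw [← withDensity_const, ← withDensity_indicator measurableSet_Ico]
  congr 1
  ext θ
  by_cases h : 0 ≤ θ ∧ θ < 2*π
  · rw [if_pos h, indicator_of_mem (show θ ∈ Ico 0 (2*π) from h)]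
  · rw [if_neg h, indicator_of_notMem (show θ ∉ Ico 0 (2*π) from h)]; simp

instance sv_unif_prob : IsProbabilityMeasure UNIFm := by
  constructor
  rw [sv_unif_eq]
  have : (0:ℝ) < 2*π := by positivity
  simp only [Measure.smul_apply, Measure.restrict_apply_univ, Real.volume_Ico, sub_zero,
    smul_eq_mul]
  rw [← ENNReal.ofReal_mul (by positivity)]
  field_simp
  simp

lemma sv_unif_carrier : UNIFm (Ico 0 (2*π))ᶜ = 0 := by
  rw [sv_unif_eq]
  simp [Measure.restrict_apply measurableSet_Ico.compl]

lemma sv_unif_avg {E : Type*} [NormedAddCommGroup E] [NormedSpace ℝ E] (f : ℂ → E) :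
    ∫ θ, f (ctheta θ) ∂UNIFm = circleAverage f 0 1 := by
  have : (0:ℝ) < 2*π := by positivity
  rw [sv_unif_eq, integral_smul_measure, circleAverage_def,
    intervalIntegral.integral_of_le this.le, integral_Ico_eq_integral_Ioo,
    integral_Ioc_eq_integral_Ioo, ENNReal.toReal_ofReal (by positivity), one_div]
  simp [circleMap, ctheta]

lemma sv_unif_poly (P : Polynomial ℂ) : ∫ θ, (P.eval (ctheta θ)).re ∂UNIFm = (P.eval 0).re := by
  have h1 := integral_re (sv_int UNIFm (fun z => P.eval z) P.continuous)
  simp only [RCLike.re_to_complex] at h1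
  rw [h1, sv_unif_avg (fun z => P.eval z), DiffContOnCl.circleAverage]
  exact P.differentiable.diffContOnCl

lemma sv_lower (ν : Measure ℝ) [IsProbabilityMeasure ν] (α : ℕ → ℂ) (hα : IsVerblunsky ν α)
    (hac : UNIFm ≪ ν) (hint : Integrable (llr UNIFm ν) UNIFm) (n : ℕ) :
    -Real.log (∏ k ∈ Finset.range n, (1 - ‖α k‖^2)) ≤ ∫ x, llr UNIFm ν x ∂UNIFm := by
  obtain ⟨Φ, hm, hD, hnz, -⟩ := sv_opuc ν α hα n
  set f : ℝ → ℝ := fun θ => 2 * Real.log ‖Φ.eval (ctheta θ)‖ with hf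
  have hfc : ContinuousOn (fun z => Real.log ‖Φ.eval z‖) (Metric.sphere 0 1) := by
    refine ContinuousOn.log (Φ.continuous.norm.continuousOn) fun z hz => ?_
    exact norm_ne_zero_iff.mpr (hnz z (by simpa using hz))
  have hef : ∀ θ, Real.exp (f θ) = ‖Φ.eval (ctheta θ)‖^2 := by
    intro θ
    have h0 : 0 < ‖Φ.eval (ctheta θ)‖ := norm_pos_iff.mpr (hnz _ (sv_norm_ctheta θ))
    rw [hf]
    simp only
    rw [mul_comm, Real.exp_mul, Real.exp_log h0]; norm_cast
  have hfU : Integrable f UNIFm := (sv_int' UNIFm _ hfc).const_mul 2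
  have hfν : Integrable (fun x => Real.exp (f x)) ν := by
    simp_rw [hef]
    exact sv_int ν (fun z => ‖Φ.eval z‖^2) (Φ.continuous.norm.pow 2)
  have h1 := integral_llr_tilted_right hac hfU hfν hint
  have hP := isProbabilityMeasure_tilted hfν
  have h2 := InformationTheory.integral_llr_add_sub_measure_univ_nonneg
    (hac.trans (absolutelyContinuous_tilted hfν)) (integrable_llr_tilted_right hac hfU hint hfν)
  simp only [probReal_univ] at h2
  have h3 : ∫ x, Real.exp (f x) ∂ν = ∏ k ∈ Finset.range n, (1 - ‖α k‖^2) := by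
    rw [← hD]; simp_rw [hef]; rfl
  have h4 : 0 ≤ ∫ x, f x ∂UNIFm := by
    rw [hf, integral_const_mul, sv_unif_avg (fun z => Real.log ‖Φ.eval z‖), ← logMahlerMeasure_def,
      logMahlerMeasure_eq_log_MahlerMeasure]
    have := one_le_mahlerMeasure_of_one_le_norm_leadingCoeff (p := Φ) (by simp [hm.leadingCoeff])
    have := Real.log_nonneg this
    linarith
  rw [h3] at h1
  linarith

lemma sv_xlog (x a b : ℝ) (hx : 0 ≤ x) (ha : 0 < a) (hb : 1 ≤ b) :
    -1 ≤ x * Real.log (max a (min x b)) := by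
  set y := max a (min x b) with hy
  have hy0 : 0 < y := lt_max_of_lt_left ha
  by_cases h1 : 1 ≤ y
  · have := mul_nonneg hx (Real.log_nonneg h1)
    linarith
  · push Not at h1
    have hmy : min x b ≤ y := le_max_right _ _
    have hxy : x ≤ y := by
      rcases min_le_iff.mp hmy with h | h
      · exact h
      · linarith
    have hl : Real.log y ≤ 0 := Real.log_nonpos hy0.le h1.le
    have h2 : 1 - y⁻¹ ≤ Real.log y := Real.one_sub_inv_le_log_of_pos hy0
    have h3 : y * (1 - y⁻¹) ≤ y * Real.log y := mul_le_mul_of_nonneg_left h2 hy0.le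
    have h4 : y * (1 - y⁻¹) = y - 1 := by field_simp
    nlinarith

lemma sv_dv {Ω : Type*} [MeasurableSpace Ω] (U ν : Measure Ω) [IsProbabilityMeasure U]
    [IsProbabilityMeasure ν] (c : ℝ)
    (h : ∀ (f : Ω → ℝ) (M : ℝ), Measurable f → (∀ x, |f x| ≤ M) →
      Real.exp (∫ x, f x ∂U) ≤ Real.exp c * ∫ x, Real.exp (f x) ∂ν) :
    U ≪ ν ∧ Integrable (llr U ν) U ∧ ∫ x, llr U ν x ∂U ≤ c := by
  have hc0 : 0 ≤ c := by
    have := h (fun _ => 0) 0 measurable_const (by simp)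
    simpa using this
  have hac : U ≪ ν := by
    refine Measure.AbsolutelyContinuous.mk fun A hA hνA => ?_
    by_contra hUA
    have hpos : 0 < U.real A := by
      rw [measureReal_def]; exact ENNReal.toReal_pos hUA (measure_ne_top _ _)
    set t := (c + 1) / U.real A with ht
    have := h (A.indicator fun _ => t) |t| (measurable_const.indicator hA) (by
      intro x
      by_cases hx : x ∈ A <;> simp [hx])
    rw [integral_indicator_const _ hA] at this
    have h2 : ∫ x, Real.exp (A.indicator (fun _ => t) x) ∂ν = 1 := by
      have : (fun x => Real.exp (A.indicator (fun _ => t) x)) =ᵐ[ν] fun _ => 1 := by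
        have : ∀ᵐ x ∂ν, x ∉ A := measure_eq_zero_iff_ae_notMem.mp hνA
        filter_upwards [this] with x hx
        simp [hx]
      rw [integral_congr_ae this]; simp
    rw [h2, mul_one, Real.exp_le_exp, smul_eq_mul, ht, mul_div_cancel₀ _ hpos.ne'] at this
    linarith
  set r : Ω → ℝ := fun x => (U.rnDeriv ν x).toReal with hr
  have hrm : Measurable r := (Measure.measurable_rnDeriv U ν).ennreal_toReal
  have hr0 : ∀ x, 0 ≤ r x := fun x => ENNReal.toReal_nonneg
  have hri : Integrable r ν := Measure.integrable_toReal_rnDeriv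
  have hr1 : ∫ x, r x ∂ν = 1 := by
    rw [hr, Measure.integral_toReal_rnDeriv hac]; simp
  set y : ℕ → Ω → ℝ := fun n x => max (1/((n:ℝ)+1)) (min (r x) ((n:ℝ)+1)) with hy
  have hym : ∀ n, Measurable (y n) := fun n => by
    rw [hy]; exact measurable_const.max (hrm.min measurable_const)
  have hypos : ∀ (n : ℕ) x, 1/((n:ℝ)+1) ≤ y n x := fun n x => le_max_left _ _
  have hple : ∀ n : ℕ, 1/((n:ℝ)+1) ≤ (n:ℝ)+1 := fun n => by
    rw [div_le_iff₀ (by positivity)]; nlinarith [(Nat.cast_nonneg n : (0:ℝ) ≤ n)]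
  have hyub : ∀ (n : ℕ) x, y n x ≤ (n:ℝ)+1 := fun n x => max_le (hple n) (min_le_right _ _)
  have hy0 : ∀ n x, 0 < y n x := fun n x => lt_of_lt_of_le (by positivity) (hypos n x)
  have hlb : ∀ (n : ℕ) x, |Real.log (y n x)| ≤ Real.log ((n:ℝ)+1) := by
    intro n x
    rw [abs_le]
    constructor
    · have := Real.log_le_log (by positivity) (hypos n x)
      rwa [one_div, Real.log_inv] at this
    · exact Real.log_le_log (hy0 n x) (hyub n x)
  have hlm : ∀ n, Measurable fun x => Real.log (y n x) := fun n => (hym n).log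
  have hyint : ∀ n : ℕ, ∫ x, y n x ∂ν ≤ 1/((n:ℝ)+1) + 1 := by
    intro n
    have : ∫ x, y n x ∂ν ≤ ∫ x, (1/((n:ℝ)+1) + r x) ∂ν := by
      refine integral_mono ?_ ((integrable_const _).add hri) ?_
      · exact Integrable.of_bound (hym n).aestronglyMeasurable ((n:ℝ)+1)
          (Eventually.of_forall fun x => by
            rw [Real.norm_eq_abs, abs_of_pos (hy0 n x)]; exact hyub n x)
      · intro x
        have hp : 0 < 1/((n:ℝ)+1) := by positivity
        refine max_le ?_ ?_
        · linarith [hr0 x]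
        · linarith [min_le_left (r x) ((n:ℝ)+1)]
    rw [integral_add (integrable_const _) hri, hr1] at this
    simpa using this
  have hkey : ∀ n : ℕ, ∫ x, r x * Real.log (y n x) ∂ν ≤ c + 1/((n:ℝ)+1) := by
    intro n
    have h1 := h _ _ (hlm n) (hlb n)
    have e1 : ∫ x, r x * Real.log (y n x) ∂ν = ∫ x, Real.log (y n x) ∂U := by
      have := integral_rnDeriv_smul hac (f := fun x => Real.log (y n x))
      simpa [hr] using this
    rw [e1]
    simp_rw [fun x => Real.exp_log (hy0 n x)] at h1
    rw [← Real.exp_le_exp]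
    refine h1.trans ?_
    rw [Real.exp_add]
    gcongr
    refine (hyint n).trans ?_
    exact Real.add_one_le_exp _
  have hgi : ∀ n, Integrable (fun x => r x * Real.log (y n x) + 1) ν := by
    intro n
    refine Integrable.add ?_ (integrable_const _)
    refine hri.mul_bdd (c := Real.log ((n:ℝ)+1)) (hlm n).aestronglyMeasurable
      (Eventually.of_forall fun x => hlb n x)
  have hg0 : ∀ n x, 0 ≤ r x * Real.log (y n x) + 1 := by
    intro n x
    have := sv_xlog (r x) (1/((n:ℝ)+1)) ((n:ℝ)+1) (hr0 x) (by positivity)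
      (by linarith [(Nat.cast_nonneg n : (0:ℝ) ≤ n)])
    linarith
  have hlim : ∀ x, Tendsto (fun n => r x * Real.log (y n x) + 1) atTop
      (𝓝 (r x * Real.log (r x) + 1)) := by
    intro x
    rcases (hr0 x).eq_or_lt with h0 | h0
    · simp [← h0]
    · refine tendsto_const_nhds.congr' ?_
      obtain ⟨N1, hN1⟩ := exists_nat_gt (r x)
      obtain ⟨N2, hN2⟩ := exists_nat_gt (1 / r x)
      filter_upwards [eventually_ge_atTop (max N1 N2)] with n hn
      have a1 : (N1:ℝ) ≤ n := by exact_mod_cast (le_max_left _ _).trans hn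
      have a2 : (N2:ℝ) ≤ n := by exact_mod_cast (le_max_right _ _).trans hn
      have b1 : min (r x) ((n:ℝ)+1) = r x := min_eq_left (by linarith)
      have b2 : 1/((n:ℝ)+1) ≤ r x := by
        rw [div_le_iff₀ (by positivity)]
        rw [div_lt_iff₀ h0] at hN2
        nlinarith
      have : y n x = r x := by rw [hy]; simp only; rw [b1, max_eq_right b2]
      rw [this]
  have hgm : Measurable fun x => r x * Real.log (r x) + 1 := (hrm.mul hrm.log).add_const 1
  have hfat : ∫⁻ x, ENNReal.ofReal (r x * Real.log (r x) + 1) ∂ν ≤ ENNReal.ofReal (c + 1) := by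
    have e : ∀ x, ENNReal.ofReal (r x * Real.log (r x) + 1) =
        liminf (fun n => ENNReal.ofReal (r x * Real.log (y n x) + 1)) atTop := fun x =>
      ((ENNReal.continuous_ofReal.tendsto _).comp (hlim x)).liminf_eq.symm
    simp_rw [e]
    refine (lintegral_liminf_le fun n =>
      ((hrm.mul (hlm n)).add_const 1).ennreal_ofReal).trans ?_
    have ht : Tendsto (fun n : ℕ => ENNReal.ofReal (c + 1/((n:ℝ)+1) + 1)) atTop
        (𝓝 (ENNReal.ofReal (c + 1))) := by
      refine (ENNReal.continuous_ofReal.tendsto _).comp ?_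
      have := (tendsto_one_div_add_atTop_nhds_zero_nat (𝕜 := ℝ))
      simpa using (this.const_add c).add_const 1
    rw [← ht.liminf_eq]
    refine liminf_le_liminf (Eventually.of_forall fun n => ?_)
    change ∫⁻ a, ENNReal.ofReal (r a * Real.log (y n a) + 1) ∂ν ≤ _
    rw [← ofReal_integral_eq_lintegral_ofReal (hgi n) (Eventually.of_forall (hg0 n))]
    refine ENNReal.ofReal_le_ofReal ?_
    rw [integral_add]
    · simp only [integral_const, probReal_univ, smul_eq_mul, mul_one]
      linarith [hkey n]
    · have := (hgi n).sub (integrable_const 1)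
      simpa [Pi.sub_def] using this
    · exact integrable_const _
  have hg0' : ∀ x, 0 ≤ r x * Real.log (r x) + 1 := fun x =>
    ge_of_tendsto' (hlim x) fun n => hg0 n x
  have hI1 : Integrable (fun x => r x * Real.log (r x) + 1) ν := by
    refine ⟨hgm.aestronglyMeasurable, ?_⟩
    rw [hasFiniteIntegral_iff_ofReal (Eventually.of_forall hg0')]
    exact hfat.trans_lt ENNReal.ofReal_lt_top
  have hI : Integrable (fun x => r x * Real.log (r x)) ν := by
    have := hI1.sub (integrable_const 1)
    simpa [Pi.sub_def] using this
  refine ⟨hac, (integrable_rnDeriv_mul_log_iff hac).mp hI, ?_⟩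
  rw [← integral_rnDeriv_mul_log hac]
  rw [← ofReal_integral_eq_lintegral_ofReal hI1 (Eventually.of_forall hg0'),
    ENNReal.ofReal_le_ofReal_iff (by linarith), integral_add hI (integrable_const _)] at hfat
  simp only [integral_const, probReal_univ, smul_eq_mul, mul_one] at hfat
  linarith

lemma sv_exp_lip (a b M : ℝ) (hb : b ≤ M) :
    Real.exp b ≤ Real.exp a + Real.exp M * |a - b| := by
  have h1 := Real.add_one_le_exp (a - b)
  have h2 : Real.exp a = Real.exp b * Real.exp (a - b) := by rw [← Real.exp_add]; congr 1; ring
  have h3 : Real.exp b * (a - b + 1) ≤ Real.exp a := by rw [h2]; gcongr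
  have h4 : Real.exp b * (b - a) ≤ Real.exp b * |a - b| := by
    gcongr; rw [abs_sub_comm]; exact le_abs_self _
  have h5 : Real.exp b * |a - b| ≤ Real.exp M * |a - b| := by gcongr
  linarith

lemma sv_cont_to_meas {X : Type*} [TopologicalSpace X] [NormalSpace X] [MeasurableSpace X]
    [BorelSpace X] (U ν : Measure X) [IsProbabilityMeasure U] [IsProbabilityMeasure ν]
    [(U + ν).WeaklyRegular] (c : ℝ)
    (h : ∀ f : X → ℝ, Continuous f → (∃ M, ∀ x, |f x| ≤ M) →
      Real.exp (∫ x, f x ∂U) ≤ Real.exp c * ∫ x, Real.exp (f x) ∂ν)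
    (f : X → ℝ) (M : ℝ) (hf : Measurable f) (hM : ∀ x, |f x| ≤ M) :
    Real.exp (∫ x, f x ∂U) ≤ Real.exp c * ∫ x, Real.exp (f x) ∂ν := by
  have hfi : ∀ μ : Measure X, IsFiniteMeasure μ → Integrable f μ := fun μ _ =>
    Integrable.of_bound hf.aestronglyMeasurable M (Eventually.of_forall hM)
  have hexpi : ∀ g : X → ℝ, Measurable g → (∀ x, |g x| ≤ M) →
      Integrable (fun x => Real.exp (g x)) ν := fun g hg hgM =>
    Integrable.of_bound hg.exp.aestronglyMeasurable (Real.exp M) (Eventually.of_forall fun x => by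
      rw [Real.norm_eq_abs, Real.abs_exp, Real.exp_le_exp]; exact (le_abs_self _).trans (hgM x))
  have key : ∀ ε > 0, Real.exp (∫ x, f x ∂U - ε) ≤
      Real.exp c * (∫ x, Real.exp (f x) ∂ν + Real.exp M * ε) := by
    intro ε hε
    obtain ⟨g, hg, hgi⟩ := (hfi (U + ν) inferInstance).exists_boundedContinuous_integral_sub_le hε
    set k : X → ℝ := fun x => max (-M) (min (g x) M) with hk
    have hkc : Continuous k := continuous_const.max (g.continuous.min continuous_const)
    have hkm : Measurable k := hkc.measurable
    have hkM : ∀ x, |k x| ≤ M := by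
      intro x
      have hM0 : 0 ≤ M := (abs_nonneg _).trans (hM x)
      rw [abs_le]
      exact ⟨le_max_left _ _, max_le (by linarith) (min_le_right _ _)⟩
    have hki : ∀ μ : Measure X, IsFiniteMeasure μ → Integrable k μ := fun μ _ =>
      Integrable.of_bound hkm.aestronglyMeasurable M (Eventually.of_forall hkM)
    have hkf : ∀ x, |f x - k x| ≤ ‖f x - g x‖ := by
      intro x
      have h1 := abs_le.mp (hM x)
      rw [Real.norm_eq_abs, hk]
      simp only
      rcases le_total (g x) M with h2 | h2
      · rw [min_eq_left h2]
        rcases le_total (-M) (g x) with h3 | h3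
        · rw [max_eq_right h3]
        · rw [max_eq_left h3, abs_of_nonneg (by linarith), abs_of_nonneg (by linarith)]
          linarith
      · rw [min_eq_right h2, max_eq_right (by linarith), abs_of_nonpos (by linarith),
          abs_of_nonpos (by linarith)]
        linarith
    have hdi : ∀ μ : Measure X, IsFiniteMeasure μ → Integrable (fun x => |f x - k x|) μ :=
      fun μ _ => ((hfi μ inferInstance).sub (hki μ inferInstance)).abs
    have hd : ∫ x, |f x - k x| ∂U + ∫ x, |f x - k x| ∂ν ≤ ε := by
      rw [← integral_add_measure (hdi U inferInstance) (hdi ν inferInstance)]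
      refine le_trans ?_ hg
      exact integral_mono (hdi _ inferInstance) ((hfi (U + ν) inferInstance).sub hgi).norm hkf
    have hU0 : 0 ≤ ∫ x, |f x - k x| ∂U := integral_nonneg fun _ => abs_nonneg _
    have hν0 : 0 ≤ ∫ x, |f x - k x| ∂ν := integral_nonneg fun _ => abs_nonneg _
    have e1 : ∫ x, f x ∂U - ε ≤ ∫ x, k x ∂U := by
      have : ∫ x, f x ∂U - ∫ x, k x ∂U ≤ ∫ x, |f x - k x| ∂U := by
        rw [← integral_sub (hfi U inferInstance) (hki U inferInstance)]
        exact integral_mono ((hfi U inferInstance).sub (hki U inferInstance))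
          (hdi U inferInstance) fun x => le_abs_self _
      linarith
    have e2 : ∫ x, Real.exp (k x) ∂ν ≤ ∫ x, Real.exp (f x) ∂ν + Real.exp M * ε := by
      have : ∫ x, Real.exp (k x) ∂ν ≤ ∫ x, (Real.exp (f x) + Real.exp M * |f x - k x|) ∂ν := by
        refine integral_mono (hexpi k hkm hkM)
          ((hexpi f hf hM).add ((hdi ν inferInstance).const_mul _)) fun x => ?_
        exact sv_exp_lip _ _ _ ((le_abs_self _).trans (hkM x))
      rw [integral_add (hexpi f hf hM) ((hdi ν inferInstance).const_mul _),
        integral_const_mul] at this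
      have h6 : Real.exp M * ∫ x, |f x - k x| ∂ν ≤ Real.exp M * ε := by
        gcongr; linarith
      linarith
    calc Real.exp (∫ x, f x ∂U - ε) ≤ Real.exp (∫ x, k x ∂U) := Real.exp_le_exp.mpr e1
      _ ≤ Real.exp c * ∫ x, Real.exp (k x) ∂ν := h k hkc ⟨M, hkM⟩
      _ ≤ _ := by gcongr
  have t1 : Tendsto (fun ε : ℝ => Real.exp (∫ x, f x ∂U - ε)) (𝓝[>] 0)
      (𝓝 (Real.exp (∫ x, f x ∂U - 0))) :=
    ((by fun_prop : Continuous fun ε : ℝ => Real.exp (∫ x, f x ∂U - ε)).tendsto 0).mono_left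
      nhdsWithin_le_nhds
  have t2 : Tendsto (fun ε : ℝ => Real.exp c * (∫ x, Real.exp (f x) ∂ν + Real.exp M * ε)) (𝓝[>] 0)
      (𝓝 (Real.exp c * (∫ x, Real.exp (f x) ∂ν + Real.exp M * 0))) :=
    ((by fun_prop : Continuous fun ε : ℝ =>
      Real.exp c * (∫ x, Real.exp (f x) ∂ν + Real.exp M * ε)).tendsto 0).mono_left
      nhdsWithin_le_nhds
  have := le_of_tendsto_of_tendsto t1 t2 (eventually_mem_nhdsWithin.mono fun ε hε => key ε hε)
  simpa using this

lemma sv_exp_poly (ν : Measure ℝ) [IsProbabilityMeasure ν] (c : ℝ)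
    (hc : ∀ P : Polynomial ℂ, ‖P.eval 0‖^2 ≤ Real.exp c * svN ν P) (h : Polynomial ℂ) :
    Real.exp (h.eval 0).re ≤ Real.exp c * ∫ θ, Real.exp (h.eval (ctheta θ)).re ∂ν := by
  set P : ℕ → Polynomial ℂ := fun N =>
    ∑ k ∈ Finset.range N, C ((Nat.factorial k : ℂ)⁻¹) * (C (2⁻¹) * h)^k with hP
  have hev : ∀ N z, (P N).eval z =
      ∑ k ∈ Finset.range N, (2⁻¹ * h.eval z)^k / (Nat.factorial k : ℂ) := by
    intro N z
    simp [hP, eval_finsetSum, div_eq_inv_mul]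
  have hlim : ∀ z, Tendsto (fun N => (P N).eval z) atTop (𝓝 (Complex.exp (2⁻¹ * h.eval z))) := by
    intro z
    simp_rw [hev, Complex.exp_eq_exp_ℂ]
    exact (NormedSpace.expSeries_div_hasSum_exp (2⁻¹ * h.eval z)).tendsto_sum_nat
  have hns : ∀ w : ℂ, ‖Complex.exp (2⁻¹ * w)‖^2 = Real.exp w.re := by
    intro w
    rw [Complex.norm_exp, ← Real.exp_nat_mul]
    congr 1
    simp
  have hlim2 : ∀ z, Tendsto (fun N => ‖(P N).eval z‖^2) atTop (𝓝 (Real.exp (h.eval z).re)) := by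
    intro z
    rw [← hns]
    exact ((hlim z).norm).pow 2
  have hbd : ∀ N z, ‖(P N).eval z‖ ≤ Real.exp ‖h.eval z‖ := by
    intro N z
    rw [hev]
    refine (norm_sum_le _ _).trans ?_
    have : ∀ k ∈ Finset.range N, ‖(2⁻¹ * h.eval z)^k / (Nat.factorial k : ℂ)‖ ≤
        ‖h.eval z‖^k / (Nat.factorial k : ℝ) := by
      intro k _
      rw [norm_div, norm_pow, norm_mul, Complex.norm_natCast]
      gcongr
      have : ‖(2⁻¹ : ℂ)‖ ≤ 1 := by norm_num
      nlinarith [norm_nonneg (h.eval z)]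
    exact (Finset.sum_le_sum this).trans (Real.sum_le_exp_of_nonneg (norm_nonneg _) N)
  obtain ⟨M, hM⟩ := sv_bdd (fun z => h.eval z) h.continuous
  have ht : Tendsto (fun N => svN ν (P N)) atTop (𝓝 (∫ θ, Real.exp (h.eval (ctheta θ)).re ∂ν)) := by
    unfold svN
    refine tendsto_integral_of_dominated_convergence (fun _ => (Real.exp M)^2)
      (fun N => ((sv_cont_poly (P N)).norm.pow 2).aestronglyMeasurable) (integrable_const _)
      (fun N => Eventually.of_forall fun θ => ?_) (Eventually.of_forall fun θ => hlim2 _)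
    rw [Real.norm_eq_abs, abs_of_nonneg (by positivity)]
    gcongr
    exact (hbd N _).trans (Real.exp_le_exp.mpr (hM θ))
  exact le_of_tendsto_of_tendsto' (hlim2 0) (ht.const_mul _) fun N => hc (P N)

instance sv_fact : Fact ((0:ℝ) < 2*π) := ⟨by positivity⟩

lemma sv_fourier (n : ℕ) (θ : ℝ) :
    fourier (n : ℤ) (θ : AddCircle (2*π)) = (ctheta θ)^n := by
  rw [fourier_coe_apply, ctheta, ← Complex.exp_nat_mul]
  congr 1
  have : (π : ℂ) ≠ 0 := by exact_mod_cast Real.pi_ne_zero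
  push_cast
  field_simp

lemma sv_trig (g : C(AddCircle (2*π), ℂ))
    (hg : g ∈ Submodule.span ℂ (Set.range (@fourier (2*π)))) :
    ∃ a b : Polynomial ℂ, ∀ θ : ℝ, g (θ : AddCircle (2*π)) =
      a.eval (ctheta θ) + conj (b.eval (ctheta θ)) := by
  induction hg using Submodule.span_induction with
  | mem x hx =>
    obtain ⟨n, rfl⟩ := hx
    obtain ⟨m, rfl | rfl⟩ := n.eq_nat_or_neg
    · exact ⟨X^m, 0, fun θ => by rw [sv_fourier]; simp⟩
    · exact ⟨0, X^m, fun θ => by rw [fourier_neg, sv_fourier]; simp⟩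
  | zero => exact ⟨0, 0, fun θ => by simp⟩
  | add x y _ _ hx hy =>
    obtain ⟨a, b, h⟩ := hx
    obtain ⟨a', b', h'⟩ := hy
    exact ⟨a + a', b + b', fun θ => by simp [h, h']; ring⟩
  | smul c x _ hx =>
    obtain ⟨a, b, h⟩ := hx
    exact ⟨C c * a, C (conj c) * b, fun θ => by simp [h]; ring⟩

lemma sv_approx (F : AddCircle (2*π) → ℝ) (hF : Continuous F) (ε : ℝ) (hε : 0 < ε) :
    ∃ h : Polynomial ℂ, ∀ θ : ℝ, |F (θ : AddCircle (2*π)) - (h.eval (ctheta θ)).re| ≤ ε := by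
  let G : C(AddCircle (2*π), ℂ) := ⟨fun x => (F x : ℂ), by fun_prop⟩
  have hG : G ∈ (Submodule.span ℂ (Set.range (@fourier (2*π)))).topologicalClosure := by
    rw [span_fourier_closure_eq_top]; trivial
  obtain ⟨g, hg, hd⟩ := Metric.mem_closure_iff.mp hG ε hε
  obtain ⟨a, b, hab⟩ := sv_trig g hg
  refine ⟨a + b, fun θ => ?_⟩
  have h1 : ‖G (θ : AddCircle (2*π)) - g (θ : AddCircle (2*π))‖ ≤ ε := by
    rw [← dist_eq_norm]
    exact (ContinuousMap.dist_apply_le_dist _).trans hd.le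
  refine le_trans ?_ h1
  have h2 := Complex.abs_re_le_norm (G (θ : AddCircle (2*π)) - g (θ : AddCircle (2*π)))
  rw [hab] at h2 ⊢
  simpa [G] using h2

lemma sv_cont (ν : Measure ℝ) [IsProbabilityMeasure ν] (c : ℝ)
    (hc : ∀ P : Polynomial ℂ, ‖P.eval 0‖^2 ≤ Real.exp c * svN ν P)
    (F : AddCircle (2*π) → ℝ) (hF : Continuous F) :
    Real.exp (∫ θ : ℝ, F (θ : AddCircle (2*π)) ∂UNIFm) ≤
      Real.exp c * ∫ θ : ℝ, Real.exp (F (θ : AddCircle (2*π))) ∂ν := by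
  have hFc : Continuous fun θ : ℝ => F (θ : AddCircle (2*π)) :=
    hF.comp (AddCircle.continuous_mk' _)
  obtain ⟨M, hM⟩ := isCompact_univ.exists_bound_of_continuousOn hF.continuousOn
  have hi1 : Integrable (fun θ : ℝ => F (θ : AddCircle (2*π))) UNIFm :=
    Integrable.of_bound hFc.aestronglyMeasurable M (Eventually.of_forall fun θ => hM _ trivial)
  have hi2 : Integrable (fun θ : ℝ => Real.exp (F (θ : AddCircle (2*π)))) ν :=
    Integrable.of_bound (Real.continuous_exp.comp hFc).aestronglyMeasurable (Real.exp M)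
      (Eventually.of_forall fun θ => by
        rw [Real.norm_eq_abs, Real.abs_exp, Real.exp_le_exp]
        exact (le_abs_self _).trans (hM _ trivial))
  have key : ∀ ε > 0, Real.exp (∫ θ : ℝ, F (θ : AddCircle (2*π)) ∂UNIFm - ε) ≤
      Real.exp c * (Real.exp ε * ∫ θ : ℝ, Real.exp (F (θ : AddCircle (2*π))) ∂ν) := by
    intro ε hε
    obtain ⟨h, hh⟩ := sv_approx F hF ε hε
    have h1 := sv_exp_poly ν c hc h
    have hre : Continuous fun z => (h.eval z).re := Complex.continuous_re.comp h.continuous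
    have hi3 : Integrable (fun θ => (h.eval (ctheta θ)).re) UNIFm :=
      sv_int UNIFm (fun z => (h.eval z).re) hre
    have hi4 : Integrable (fun θ => Real.exp (h.eval (ctheta θ)).re) ν :=
      sv_int ν (fun z => Real.exp (h.eval z).re) (Real.continuous_exp.comp hre)
    have e1 : ∫ θ : ℝ, F (θ : AddCircle (2*π)) ∂UNIFm - ε ≤ (h.eval 0).re := by
      rw [← sv_unif_poly]
      have : ∫ θ : ℝ, F (θ : AddCircle (2*π)) ∂UNIFm ≤
          ∫ θ, ((h.eval (ctheta θ)).re + ε) ∂UNIFm :=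
        integral_mono hi1 (hi3.add (integrable_const _)) fun θ => by
          have := (abs_le.mp (hh θ)).2
          simp only; linarith
      rw [integral_add hi3 (integrable_const _)] at this
      simp only [integral_const, probReal_univ, smul_eq_mul, one_mul] at this
      linarith
    have e2 : ∫ θ, Real.exp (h.eval (ctheta θ)).re ∂ν ≤
        Real.exp ε * ∫ θ : ℝ, Real.exp (F (θ : AddCircle (2*π))) ∂ν := by
      rw [← integral_const_mul]
      refine integral_mono hi4 (hi2.const_mul _) fun θ => ?_
      simp only
      rw [← Real.exp_add, Real.exp_le_exp]
      have := (abs_le.mp (hh θ)).1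
      linarith
    calc _ ≤ Real.exp (h.eval 0).re := Real.exp_le_exp.mpr e1
      _ ≤ _ := h1
      _ ≤ _ := by gcongr
  set A := ∫ θ : ℝ, F (θ : AddCircle (2*π)) ∂UNIFm
  set B := ∫ θ : ℝ, Real.exp (F (θ : AddCircle (2*π))) ∂ν
  have t1 : Tendsto (fun ε : ℝ => Real.exp (A - ε)) (𝓝[>] 0) (𝓝 (Real.exp (A - 0))) :=
    ((by fun_prop : Continuous fun ε : ℝ => Real.exp (A - ε)).tendsto 0).mono_left
      nhdsWithin_le_nhds
  have t2 : Tendsto (fun ε : ℝ => Real.exp c * (Real.exp ε * B)) (𝓝[>] 0)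
      (𝓝 (Real.exp c * (Real.exp 0 * B))) :=
    ((by fun_prop : Continuous fun ε : ℝ => Real.exp c * (Real.exp ε * B)).tendsto 0).mono_left
      nhdsWithin_le_nhds
  have := le_of_tendsto_of_tendsto t1 t2 (eventually_mem_nhdsWithin.mono fun ε hε => key ε hε)
  simpa using this

lemma sv_upper (ν : Measure ℝ) [IsProbabilityMeasure ν] (hcirc : ν (Ico 0 (2*π))ᶜ = 0) (c : ℝ)
    (hc : ∀ P : Polynomial ℂ, ‖P.eval 0‖^2 ≤ Real.exp c * svN ν P) :
    UNIFm ≪ ν ∧ Integrable (llr UNIFm ν) UNIFm ∧ ∫ x, llr UNIFm ν x ∂UNIFm ≤ c := by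
  refine sv_dv UNIFm ν c fun f M hf hM => ?_
  let p : ℝ → AddCircle (2*π) := fun θ => (θ : AddCircle (2*π))
  have hpm : Measurable p := AddCircle.measurable_mk'
  have hU : IsProbabilityMeasure (UNIFm.map p) := Measure.isProbabilityMeasure_map hpm.aemeasurable
  have hν : IsProbabilityMeasure (ν.map p) := Measure.isProbabilityMeasure_map hpm.aemeasurable
  let g : AddCircle (2*π) → ℝ := fun x => f (AddCircle.measurableEquivIco (2*π) 0 x : ℝ)
  have hgm : Measurable g :=
    hf.comp (measurable_subtype_coe.comp (AddCircle.measurableEquivIco (2*π) 0).measurable)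
  have hgp : ∀ θ ∈ Ico 0 (2*π), g (p θ) = f θ := by
    intro θ hθ
    have hθ' : θ ∈ Ico 0 (0 + 2*π) := by simpa using hθ
    change f ((AddCircle.equivIco (2*π) 0 (θ : AddCircle (2*π)) : Ico (0:ℝ) (0 + 2*π)) : ℝ) = f θ
    rw [AddCircle.equivIco_coe_eq hθ']
  have hae : ∀ μ : Measure ℝ, μ (Ico 0 (2*π))ᶜ = 0 → ∀ᵐ θ ∂μ, g (p θ) = f θ := by
    intro μ hμ
    have : ∀ᵐ θ ∂μ, θ ∈ Ico 0 (2*π) := hμ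
    filter_upwards [this] with θ hθ using hgp θ hθ
  have h := sv_cont_to_meas (UNIFm.map p) (ν.map p) c (by
    intro F hF _
    rw [integral_map hpm.aemeasurable hF.aestronglyMeasurable,
      integral_map hpm.aemeasurable hF.measurable.exp.aestronglyMeasurable]
    exact sv_cont ν c hc F hF) g M hgm (fun x => hM _)
  rw [integral_map hpm.aemeasurable hgm.aestronglyMeasurable,
      integral_map hpm.aemeasurable hgm.exp.aestronglyMeasurable,
      integral_congr_ae (hae UNIFm sv_unif_carrier),
      integral_congr_ae ((hae ν hcirc).mono fun θ h => congrArg Real.exp h)] at h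
  exact h

/-- **Szegő–Verblunsky sum rule.** -/
theorem szego_verblunsky_sum_rule (ν : Measure ℝ) [IsProbabilityMeasure ν]
    (hcirc : ν (Ico 0 (2*π))ᶜ = 0) (hnt : InfiniteSupport ν)
    (α : ℕ → ℂ) (hα : IsVerblunsky ν α) :
    KLdiv UNIFm ν = ∑' k : ℕ, ENNReal.ofReal (-Real.log (1 - ‖α k‖^2)) := by
  have hpos : ∀ k, 0 < 1 - ‖α k‖^2 := fun k => by
    have := hα.1 k
    have := norm_nonneg (α k)
    nlinarith
  have hnn : ∀ k, 0 ≤ -Real.log (1 - ‖α k‖^2) := fun k => by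
    have := Real.log_nonpos (hpos k).le (by nlinarith [norm_nonneg (α k)])
    linarith
  have hpart : ∀ n, ∑ k ∈ Finset.range n, ENNReal.ofReal (-Real.log (1 - ‖α k‖^2)) =
      ENNReal.ofReal (-Real.log (∏ k ∈ Finset.range n, (1 - ‖α k‖^2))) := by
    intro n
    rw [← ENNReal.ofReal_sum_of_nonneg fun k _ => hnn k,
      Real.log_prod fun k _ => (hpos k).ne', Finset.sum_neg_distrib]
  have hDpos : ∀ n, 0 < ∏ k ∈ Finset.range n, (1 - ‖α k‖^2) := fun n =>
    Finset.prod_pos fun k _ => hpos k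
  apply le_antisymm
  · by_cases htop : ∑' k : ℕ, ENNReal.ofReal (-Real.log (1 - ‖α k‖^2)) = ⊤
    · rw [htop]; exact le_top
    set c := (∑' k : ℕ, ENNReal.ofReal (-Real.log (1 - ‖α k‖^2))).toReal with hc
    have hD : ∀ n, 1 ≤ Real.exp c * ∏ k ∈ Finset.range n, (1 - ‖α k‖^2) := by
      intro n
      have h1 : -Real.log (∏ k ∈ Finset.range n, (1 - ‖α k‖^2)) ≤ c := by
        rw [hc, ← ENNReal.ofReal_le_iff_le_toReal htop, ← hpart]
        exact ENNReal.sum_le_tsum _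
      have h2 : Real.exp (-c) ≤ ∏ k ∈ Finset.range n, (1 - ‖α k‖^2) := by
        rw [← Real.le_log_iff_exp_le (hDpos n)]; linarith
      calc (1:ℝ) = Real.exp c * Real.exp (-c) := by rw [← Real.exp_add]; simp
        _ ≤ _ := by gcongr
    have hP : ∀ P : Polynomial ℂ, ‖P.eval 0‖^2 ≤ Real.exp c * svN ν P := by
      intro P
      obtain ⟨Φ, -, hN, -, hmin⟩ := sv_opuc ν α hα P.natDegree
      have h1 := hmin P le_rfl
      rw [hN] at h1
      have h2 := hD P.natDegree
      calc ‖P.eval 0‖^2 ≤ ‖P.eval 0‖^2 *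
            (Real.exp c * ∏ k ∈ Finset.range P.natDegree, (1 - ‖α k‖^2)) :=
            le_mul_of_one_le_right (by positivity) h2
        _ = Real.exp c * (‖P.eval 0‖^2 * ∏ k ∈ Finset.range P.natDegree, (1 - ‖α k‖^2)) := by ring
        _ ≤ _ := by gcongr
    obtain ⟨h1, h2, h3⟩ := sv_upper ν hcirc c hP
    unfold KLdiv
    rw [if_pos ⟨h1, h2⟩]
    exact ENNReal.ofReal_le_of_le_toReal h3
  · unfold KLdiv
    split_ifs with h
    · rw [ENNReal.tsum_eq_iSup_nat]
      refine iSup_le fun n => ?_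
      rw [hpart]
      exact ENNReal.ofReal_le_ofReal (sv_lower ν α hα h.1 h.2 n)
    · exact le_top

end SumRules
end
end
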